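/- Let K be a convex body in ℝⁿ with V(K) = V(B). Then 𝓔(K) ≥ 0, i.e., sup_{x ∈ int K} ∫_{S^{n-1}} log(s_K(u) − x·u) dθ ≥ 0. -/

import Mathlib

open MeasureTheory Metric Real Set
open scoped Pointwise RealInnerProductSpace

noncomputable section

/-- The surface measure `dθ` on the unit sphere `S^{n-1}` of `ℝⁿ`
(its total mass is `n·V(B)`). -/
def sphMeasure (n : ℕ) : Measure (Metric.sphere (0 : EuclideanSpace ℝ (Fin n)) 1) :=
  (volume : Measure (EuclideanSpace ℝ (Fin n))).toSphere

/-- `K` is a convex body: compact, convex, with nonempty interior. -/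
def IsConvexBody {n : ℕ} (K : Set (EuclideanSpace ℝ (Fin n))) : Prop :=
  IsCompact K ∧ Convex ℝ K ∧ (interior K).Nonempty

/-- The support function of `K`: `s_K(u) = max_{x ∈ K} x·u`. -/
def supp {n : ℕ} (K : Set (EuclideanSpace ℝ (Fin n))) (u : EuclideanSpace ℝ (Fin n)) : ℝ :=
  sSup ((fun x => ⟪x, u⟫) '' K)

/-- `n`-dimensional Lebesgue measure (volume), as a real number. -/
def vol {n : ℕ} (K : Set (EuclideanSpace ℝ (Fin n))) : ℝ :=
  (volume K).toReal

/-- The closed unit ball `B` of `ℝⁿ`. -/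
def unitBall (n : ℕ) : Set (EuclideanSpace ℝ (Fin n)) :=
  Metric.closedBall 0 1

/-- The entropy functional `𝓔(K) = sup_{x ∈ int K} ∫_{S^{n-1}} log (s_K(u) - x·u) dθ`. -/
def entropy {n : ℕ} (K : Set (EuclideanSpace ℝ (Fin n))) : ℝ :=
  sSup ((fun x => ∫ u, Real.log (supp K u - ⟪x, (u : EuclideanSpace ℝ (Fin n))⟫)
      ∂(sphMeasure n)) '' interior K)

/-- The `p`-entropy functional `𝓔_p(K) = inf_{x ∈ int K} ∫_{S^{n-1}} (s_K(u) - x·u)^p dθ`. -/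
def entropyP {n : ℕ} (p : ℝ) (K : Set (EuclideanSpace ℝ (Fin n))) : ℝ :=
  sInf ((fun x => ∫ u, (supp K u - ⟪x, (u : EuclideanSpace ℝ (Fin n))⟫) ^ p
      ∂(sphMeasure n)) '' interior K)

/-- The Hausdorff distance between convex bodies,
`δ_H(K,L) = sup_{u ∈ S^{n-1}} |s_K(u) - s_L(u)|`. -/
def hdist {n : ℕ} (K L : Set (EuclideanSpace ℝ (Fin n))) : ℝ :=
  ⨆ u : Metric.sphere (0 : EuclideanSpace ℝ (Fin n)) 1, |supp K u - supp L u|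

theorem san_bm1_compact {K L S : Set ℝ} (hK : IsCompact K) (hL : IsCompact L)
    (hKn : K.Nonempty) (hLn : L.Nonempty)
    (h : ∀ a ∈ K, ∀ b ∈ L, (a + b) / 2 ∈ S) : volume K + volume L ≤ 2 * volume S := by
  obtain ⟨M, hM, hM'⟩ := hK.exists_isGreatest hKn
  obtain ⟨m, hm, hm'⟩ := hL.exists_isLeast hLn
  have h1 : volume ((2:ℝ) • S) = 2 * volume S := by
    rw [Measure.addHaar_smul]; simp
  rw [← h1]
  set U := (fun x => m + x) '' K
  set W := (fun x => M + x) '' L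
  have hU : volume U = volume K := by simp [U]
  have hW : volume W = volume L := by simp [W]
  have hWm : MeasurableSet W := (hL.image (by fun_prop)).measurableSet
  have hi : volume (U ∩ W) = 0 := by
    refine measure_mono_null (t := {M + m}) ?_ (by simp)
    rintro x ⟨⟨a, ha, rfl⟩, ⟨b, hb, hx⟩⟩
    have := hM' ha
    have := hm' hb
    simp only [mem_singleton_iff] at *
    linarith
  have hs : U ∪ W ⊆ (2:ℝ) • S := by
    rintro x (⟨a, ha, rfl⟩ | ⟨b, hb, rfl⟩)
    · exact ⟨_, h a ha m hm, by simp only [smul_eq_mul]; ring⟩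
    · exact ⟨_, h M hM b hb, by simp only [smul_eq_mul]; ring⟩
  calc volume K + volume L = volume (U ∪ W) + volume (U ∩ W) := by
        rw [measure_union_add_inter _ hWm, hU, hW]
    _ ≤ _ := by rw [hi, add_zero]; exact measure_mono hs

theorem san_bm1 {A B S : Set ℝ} (hA : MeasurableSet A) (hB : MeasurableSet B)
    (hAn : A.Nonempty) (hBn : B.Nonempty)
    (h : ∀ a ∈ A, ∀ b ∈ B, (a + b) / 2 ∈ S) : volume A + volume B ≤ 2 * volume S := by
  obtain ⟨a, ha⟩ := hAn
  obtain ⟨b, hb⟩ := hBn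
  rw [hA.measure_eq_iSup_isCompact, hB.measure_eq_iSup_isCompact]
  have e : ∀ A : Set ℝ, (⨆ (K : Set ℝ), ⨆ (_ : K ⊆ A), ⨆ (_ : IsCompact K), volume K) =
      ⨆ (K : Set ℝ), ⨆ (_ : K ⊆ A ∧ IsCompact K), volume K := by
    intro A; simp only [iSup_and]
  rw [e, e]
  refine ENNReal.biSup_add_biSup_le' (p := fun K => K ⊆ A ∧ IsCompact K)
    (q := fun K => K ⊆ B ∧ IsCompact K) ⟨∅, by simp⟩ ⟨∅, by simp⟩ ?_
  rintro K ⟨hK, hK'⟩ L ⟨hL, hL'⟩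
  calc volume K + volume L ≤ volume (insert a K) + volume (insert b L) := by
        gcongr <;> exact subset_insert _ _
    _ ≤ _ := san_bm1_compact (hK'.insert a) (hL'.insert b) (by simp) (by simp)
        fun x hx y hy => h x (insert_subset ha hK hx) y (insert_subset hb hL hy)

/-- normalised version of one-dimensional Prékopa-Leindler -/
theorem san_pl_norm {F G H : ℝ → ℝ} (hF : Measurable F) (hG : Measurable G) (hH : Measurable H)
    (hF0 : ∀ x, 0 ≤ F x) (hG0 : ∀ x, 0 ≤ G x) (hH0 : ∀ x, 0 ≤ H x)
    (hF1 : ∀ x, F x ≤ 1) (hG1 : ∀ x, G x ≤ 1)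
    (hFs : ∀ l < 1, ∃ x, l < F x) (hGs : ∀ l < 1, ∃ x, l < G x)
    (h : ∀ a b, F a * G b ≤ H ((a + b) / 2) ^ 2) :
    (∫⁻ x, ENNReal.ofReal (F x)) + (∫⁻ x, ENNReal.ofReal (G x)) ≤
      2 * ∫⁻ x, ENNReal.ofReal (H x) := by
  rw [lintegral_eq_lintegral_meas_lt _ (.of_forall hF0) hF.aemeasurable,
    lintegral_eq_lintegral_meas_lt _ (.of_forall hG0) hG.aemeasurable,
    lintegral_eq_lintegral_meas_lt _ (.of_forall hH0) hH.aemeasurable]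
  rw [← lintegral_add_left', ← lintegral_const_mul']
  · refine lintegral_mono_ae ?_
    filter_upwards [self_mem_ae_restrict measurableSet_Ioi] with l hl
    by_cases hl1 : l < 1
    · refine san_bm1 (measurableSet_lt measurable_const hF) (measurableSet_lt measurable_const hG)
        (hFs l hl1) (hGs l hl1) ?_
      intro a ha b hb
      have h1 := h a b
      simp only [mem_ofPred_eq, mem_Ioi] at *
      have : l ^ 2 < H ((a + b) / 2) ^ 2 := by nlinarith
      exact lt_of_pow_lt_pow_left₀ 2 (hH0 _) this
    · have e1 : {a | l < F a} = ∅ := by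
        ext x; simp; linarith [hF1 x]
      have e2 : {a | l < G a} = ∅ := by
        ext x; simp; linarith [hG1 x]
      rw [e1, e2]; simp
  · simp
  · have : Antitone fun t => volume {a | t < F a} := fun s t hst =>
      measure_mono fun x hx => lt_of_le_of_lt hst hx
    exact this.measurable.aemeasurable

theorem san_pl_bdd {F G H : ℝ → ℝ} (hF : Measurable F) (hG : Measurable G) (hH : Measurable H)
    (hF0 : ∀ x, 0 ≤ F x) (hG0 : ∀ x, 0 ≤ G x) (hH0 : ∀ x, 0 ≤ H x)
    (hFb : BddAbove (range F)) (hGb : BddAbove (range G))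
    (h : ∀ a b, F a * G b ≤ H ((a + b) / 2) ^ 2) :
    (∫⁻ x, ENNReal.ofReal (F x)) * (∫⁻ x, ENNReal.ofReal (G x)) ≤
      (∫⁻ x, ENNReal.ofReal (H x)) ^ 2 := by
  by_cases hFz : ∀ x, F x = 0
  · simp [hFz]
  by_cases hGz : ∀ x, G x = 0
  · simp [hGz]
  push Not at hFz hGz
  obtain ⟨x0, hx0⟩ := hFz
  obtain ⟨y0, hy0⟩ := hGz
  set A := ⨆ x, F x
  set B := ⨆ x, G x
  have hA : 0 < A := lt_of_lt_of_le (lt_of_le_of_ne (hF0 x0) hx0.symm) (le_ciSup hFb x0)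
  have hB : 0 < B := lt_of_lt_of_le (lt_of_le_of_ne (hG0 y0) hy0.symm) (le_ciSup hGb y0)
  have hAB : 0 < √(A * B) := by positivity
  have key := san_pl_norm (F := fun x => A⁻¹ * F x) (G := fun x => B⁻¹ * G x)
    (H := fun x => (√(A * B))⁻¹ * H x) (by fun_prop) (by fun_prop) (by fun_prop)
    (fun x => mul_nonneg (by positivity) (hF0 x)) (fun x => mul_nonneg (by positivity) (hG0 x))
    (fun x => mul_nonneg (by positivity) (hH0 x))
    (fun x => by
      rw [inv_mul_le_iff₀ hA, mul_one]; exact le_ciSup hFb x)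
    (fun x => by
      rw [inv_mul_le_iff₀ hB, mul_one]; exact le_ciSup hGb x)
    (fun l hl => by
      obtain ⟨x, hx⟩ := exists_lt_of_lt_ciSup (show A * l < ⨆ x, F x from by
        change A * l < A; nlinarith)
      exact ⟨x, by rwa [lt_inv_mul_iff₀ hA]⟩)
    (fun l hl => by
      obtain ⟨x, hx⟩ := exists_lt_of_lt_ciSup (show B * l < ⨆ x, G x from by
        change B * l < B; nlinarith)
      exact ⟨x, by rwa [lt_inv_mul_iff₀ hB]⟩)
    (fun a b => by
      rw [mul_pow, inv_pow, Real.sq_sqrt (by positivity), mul_inv]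
      calc A⁻¹ * F a * (B⁻¹ * G b) = A⁻¹ * B⁻¹ * (F a * G b) := by ring
        _ ≤ _ := by gcongr; exact h a b)
  have sc : ∀ c : ℝ, 0 < c → ∀ f : ℝ → ℝ, ∫⁻ x, ENNReal.ofReal (c⁻¹ * f x) =
      (ENNReal.ofReal c)⁻¹ * ∫⁻ x, ENNReal.ofReal (f x) := by
    intro c hc f
    rw [← lintegral_const_mul']
    · simp_rw [ENNReal.ofReal_mul (inv_nonneg.2 hc.le), ENNReal.ofReal_inv_of_pos hc]
    · simp [hc]
  rw [sc _ hA, sc _ hB, sc _ hAB] at key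
  set IF := ∫⁻ x, ENNReal.ofReal (F x)
  set IG := ∫⁻ x, ENNReal.ofReal (G x)
  set IH := ∫⁻ x, ENNReal.ofReal (H x)
  by_cases hIH : IH = ⊤
  · simp [hIH]
  have hr : ∀ c : ℝ, 0 < c → (ENNReal.ofReal c)⁻¹ ≠ ⊤ ∧ (ENNReal.ofReal c)⁻¹ ≠ 0 := by
    intro c hc; simp [hc]
  have hkt : 2 * ((ENNReal.ofReal √(A * B))⁻¹ * IH) ≠ ⊤ :=
    ENNReal.mul_ne_top (by simp) (ENNReal.mul_ne_top (hr _ hAB).1 hIH)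
  have hsum := ne_top_of_le_ne_top hkt key
  rw [ENNReal.add_ne_top] at hsum
  have hIF : IF ≠ ⊤ := fun hh => hsum.1 (by rw [hh]; exact ENNReal.mul_top (hr _ hA).2)
  have hIG : IG ≠ ⊤ := fun hh => hsum.2 (by rw [hh]; exact ENNReal.mul_top (hr _ hB).2)
  rw [← ENNReal.toReal_le_toReal (ENNReal.mul_ne_top hIF hIG) (ENNReal.pow_ne_top hIH)]
  rw [← ENNReal.toReal_le_toReal (by simpa using hsum) hkt,
    ENNReal.toReal_add hsum.1 hsum.2] at key
  simp only [ENNReal.toReal_mul, ENNReal.toReal_pow, ENNReal.toReal_inv, 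
    ENNReal.toReal_ofReal hA.le, ENNReal.toReal_ofReal hB.le, ENNReal.toReal_ofReal hAB.le,
    ENNReal.toReal_ofNat] at key ⊢
  have p1 : 0 ≤ IF.toReal := ENNReal.toReal_nonneg
  have p2 : 0 ≤ IG.toReal := ENNReal.toReal_nonneg
  have p3 : 0 ≤ IH.toReal := ENNReal.toReal_nonneg
  generalize IF.toReal = u at *
  generalize IG.toReal = v at *
  generalize IH.toReal = w at *
  have hq : (A⁻¹ * u + B⁻¹ * v) ^ 2 ≤ (2 * ((√(A * B))⁻¹ * w)) ^ 2 := by gcongr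
  rw [mul_pow 2, mul_pow _ w, inv_pow, Real.sq_sqrt (by positivity)] at hq
  have h4 : 4 * ((A⁻¹ * u) * (B⁻¹ * v)) ≤ (A⁻¹ * u + B⁻¹ * v) ^ 2 := by
    nlinarith [sq_nonneg (A⁻¹ * u - B⁻¹ * v)]
  have h5 : (A * B)⁻¹ * (u * v) ≤ (A * B)⁻¹ * w ^ 2 := by
    rw [mul_inv] at *
    nlinarith
  exact le_of_mul_le_mul_left h5 (by positivity)

theorem san_pl {F G H : ℝ → ℝ} (hF : Measurable F) (hG : Measurable G) (hH : Measurable H)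
    (hF0 : ∀ x, 0 ≤ F x) (hG0 : ∀ x, 0 ≤ G x) (hH0 : ∀ x, 0 ≤ H x)
    (h : ∀ a b, F a * G b ≤ H ((a + b) / 2) ^ 2) :
    (∫⁻ x, ENNReal.ofReal (F x)) * (∫⁻ x, ENNReal.ofReal (G x)) ≤
      (∫⁻ x, ENNReal.ofReal (H x)) ^ 2 := by
  have mono : ∀ f : ℝ → ℝ, Measurable f → Filter.Tendsto
      (fun n : ℕ => ∫⁻ x, ENNReal.ofReal (min (f x) n)) Filter.atTop
      (nhds (∫⁻ x, ENNReal.ofReal (f x))) := by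
    intro f hf
    refine lintegral_tendsto_of_tendsto_of_monotone (fun n => by fun_prop) ?_ ?_
    · refine .of_forall fun x n m hnm => ?_
      dsimp only
      gcongr
    · refine .of_forall fun x => ?_
      refine tendsto_const_nhds.congr' ?_
      obtain ⟨N, hN⟩ := exists_nat_ge (f x)
      filter_upwards [Filter.eventually_ge_atTop N] with n hn
      rw [min_eq_left]
      exact hN.trans (by exact_mod_cast hn)
  have key : ∀ n : ℕ, (∫⁻ x, ENNReal.ofReal (min (F x) n)) * (∫⁻ x, ENNReal.ofReal (min (G x) n)) ≤
      (∫⁻ x, ENNReal.ofReal (H x)) ^ 2 := by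
    intro n
    refine san_pl_bdd (by fun_prop) (by fun_prop) hH (fun x => le_min (hF0 x) (by positivity))
      (fun x => le_min (hG0 x) (by positivity)) hH0 ⟨n, ?_⟩ ⟨n, ?_⟩ ?_
    · rintro _ ⟨x, rfl⟩; exact min_le_right _ _
    · rintro _ ⟨x, rfl⟩; exact min_le_right _ _
    · intro a b
      refine le_trans ?_ (h a b)
      exact mul_le_mul (min_le_left _ _) (min_le_left _ _) (le_min (hG0 b) (by positivity)) (hF0 a)
  by_cases hIF : ∫⁻ x, ENNReal.ofReal (F x) = 0
  · simp [hIF]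
  by_cases hIG : ∫⁻ x, ENNReal.ofReal (G x) = 0
  · simp [hIG]
  exact le_of_tendsto (ENNReal.Tendsto.mul (mono F hF) (.inl hIF) (mono G hG) (.inl hIG))
    (.of_forall key)

theorem san_exp_subst (f : ℝ → ENNReal) :
    ∫⁻ s in Ioi (0:ℝ), f s = ∫⁻ a, ENNReal.ofReal (exp a) * f (exp a) := by
  have := lintegral_image_eq_lintegral_abs_deriv_mul (s := univ) (f := exp) (f' := exp)
    MeasurableSet.univ (fun x _ => (Real.hasDerivAt_exp x).hasDerivWithinAt)
    Real.exp_injective.injOn f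
  simpa [image_univ, Real.range_exp] using this

theorem san_gauss_half : ∫⁻ s in Ioi (0:ℝ), ENNReal.ofReal (exp (-s ^ 2 / 2)) =
    ENNReal.ofReal (√(π / 2)) := by
  rw [← ofReal_integral_eq_lintegral_ofReal]
  · congr 1
    have := integral_gaussian_Ioi (1 / 2)
    have e : (fun s : ℝ => exp (-s ^ 2 / 2)) = fun s => exp (-(1 / 2) * s ^ 2) := by
      ext s; congr 1; ring
    rw [e, this]
    rw [show π / (1 / 2) = (2 : ℝ) ^ 2 * (π / 2) by ring, Real.sqrt_mul (by positivity),
      Real.sqrt_sq (by norm_num)]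
    ring
  · have := integrable_exp_neg_mul_sq (b := 1 / 2) (by norm_num)
    refine (this.congr ?_).integrableOn
    refine .of_forall fun s => ?_
    dsimp only; congr 1; ring
  · exact .of_forall fun x => (exp_pos _).le

/-- one-dimensional multiplicative inequality -/
theorem san_one {p q : ℝ → ℝ} (hp : Measurable p) (hq : Measurable q)
    (hp0 : ∀ x, 0 ≤ p x) (hq0 : ∀ x, 0 ≤ q x) {c : ℝ} (hc : 0 ≤ c)
    (h : ∀ s t, 0 < s → 0 < t → p s * q t ≤ c * exp (-(s * t))) :
    (∫⁻ s in Ioi (0:ℝ), ENNReal.ofReal (p s)) * (∫⁻ s in Ioi (0:ℝ), ENNReal.ofReal (q s)) ≤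
      ENNReal.ofReal (c * (π / 2)) := by
  have := san_pl (F := fun a => exp a * p (exp a)) (G := fun a => exp a * q (exp a))
    (H := fun a => exp a * (√c * exp (-(exp a) ^ 2 / 2))) (by fun_prop) (by fun_prop) (by fun_prop)
    (fun x => mul_nonneg (exp_pos _).le (hp0 _)) (fun x => mul_nonneg (exp_pos _).le (hq0 _))
    (fun x => by positivity) ?_
  · simp_rw [ENNReal.ofReal_mul (exp_pos _).le] at this
    rw [← san_exp_subst (fun x => ENNReal.ofReal (p x)),
      ← san_exp_subst (fun x => ENNReal.ofReal (q x)),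
      ← san_exp_subst (fun x => ENNReal.ofReal (√c * exp (- x ^ 2 / 2)))] at this
    simp_rw [ENNReal.ofReal_mul (Real.sqrt_nonneg c)] at this
    rw [lintegral_const_mul' _ _ (by simp), san_gauss_half, ← ENNReal.ofReal_mul (by positivity),
      ← ENNReal.ofReal_pow (by positivity), mul_pow, Real.sq_sqrt hc,
      Real.sq_sqrt (by positivity)] at this
    exact this
  · intro a b
    have h1 := h (exp a) (exp b) (exp_pos _) (exp_pos _)
    have e1 : exp ((a + b) / 2) ^ 2 = exp a * exp b := by
      rw [← Real.exp_add, ← Real.exp_nat_mul]; congr 1; push_cast; ring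
    rw [mul_pow, mul_pow, Real.sq_sqrt hc, e1]
    have e2 : exp (-(exp a * exp b) / 2) ^ 2 = exp (-(exp a * exp b)) := by
      rw [← Real.exp_nat_mul]; congr 1; push_cast; ring
    rw [e2]
    have : 0 < exp a * exp b := by positivity
    nlinarith

def SantaloP (E : Type) [NormedAddCommGroup E] [InnerProductSpace ℝ E] [MeasureSpace E]
    (C : ℝ) : Prop :=
  ∀ (f g : E → ℝ) (c : ℝ), Measurable f → Measurable g → (∀ x, 0 ≤ f x) → (∀ x, 0 ≤ g x) →
    Integrable f → Integrable g → Integrable (fun y => ‖y‖ * g y) → ∫ y, g y • y = 0 → 0 ≤ c →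
    (∀ x y, f x * g y ≤ c * exp (-⟪x, y⟫)) → (∫ x, f x) * (∫ y, g y) ≤ c * C

section prodstep
variable {E : Type} [NormedAddCommGroup E] [InnerProductSpace ℝ E] [FiniteDimensional ℝ E]
  [MeasurableSpace E] [BorelSpace E]

noncomputable def muP (E : Type) [NormedAddCommGroup E] [InnerProductSpace ℝ E] [FiniteDimensional ℝ E]
  [MeasurableSpace E] [BorelSpace E] : Measure (ℝ × E) :=
  (volume.restrict (Ioi (0:ℝ))).prod volume

def refl1 (z : ℝ × E) : ℝ × E := (-z.1, z.2)

theorem measurable_refl1 : Measurable (refl1 : ℝ × E → ℝ × E) := by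
  unfold refl1; fun_prop

theorem muP_ac : (muP E) ≤ volume := by
  rw [muP, Measure.volume_eq_prod]
  have := Measure.prod_restrict (μ := (volume : Measure ℝ)) (ν := (volume : Measure E)) (Ioi 0) univ
  rw [Measure.restrict_univ] at this
  rw [this]
  exact Measure.restrict_le_self

theorem muP_split : (volume : Measure (ℝ × E)) = muP E + (muP E).map refl1 := by
  have e : (muP E).map refl1 = (volume.restrict (Iio (0:ℝ))).prod volume := by
    have h1 : (refl1 : ℝ × E → ℝ × E) = Prod.map Neg.neg id := by ext z <;> simp [refl1]
    rw [h1, muP, ← Measure.map_prod_map _ _ measurable_neg measurable_id, Measure.map_id]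
    congr 1
    have := (Measure.measurePreserving_neg (volume : Measure ℝ)).restrict_preimage
      (s := Iio 0) measurableSet_Iio
    simp at this
    exact this.map_eq
  rw [e, muP, ← Measure.add_prod, Measure.volume_eq_prod]
  congr 1
  rw [Measure.restrict_congr_set (Ioi_ae_eq_Ici (a := (0:ℝ))), ← Measure.restrict_union _ measurableSet_Iio]
  · rw [union_comm, Iio_union_Ici, Measure.restrict_univ]
  · rw [disjoint_comm]; exact Iio_disjoint_Ici le_rfl

theorem muP_integral {F : Type} [NormedAddCommGroup F] [NormedSpace ℝ F] {g : ℝ × E → F}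
    (hg : Integrable g) :
    Integrable g (muP E) ∧ Integrable (fun z => g (refl1 z)) (muP E) ∧
    ∫ z, g z = ∫ z, g z ∂(muP E) + ∫ z, g (refl1 z) ∂(muP E) := by
  rw [muP_split, integrable_add_measure] at hg
  have h2 := hg.2.comp_measurable measurable_refl1
  refine ⟨hg.1, h2, ?_⟩
  rw [muP_split, integral_add_measure hg.1 hg.2, integral_map measurable_refl1.aemeasurable hg.2.1]

theorem half_lemma {C : ℝ} (hP : SantaloP E C) {f g : ℝ × E → ℝ} {c : ℝ} (hf : Measurable f)
    (hg : Measurable g) (hf0 : ∀ x, 0 ≤ f x) (hg0 : ∀ x, 0 ≤ g x)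
    (hfi : Integrable f (muP E)) (hgi : Integrable g (muP E))
    (hgn : Integrable (fun z => ‖z.2‖ * g z) (muP E))
    (hb : ∫ z, g z • z.2 ∂(muP E) = 0) (hc : 0 ≤ c)
    (h : ∀ s t x y, 0 < s → 0 < t → f (s, x) * g (t, y) ≤ c * exp (-(s * t + ⟪x, y⟫))) :
    (∫ z, f z ∂(muP E)) * (∫ z, g z ∂(muP E)) ≤ c * (π / 2) * C := by
  unfold muP at *
  rw [integral_prod_symm _ hfi, integral_prod_symm _ hgi]
  have hbi : Integrable (fun z : ℝ × E => g z • z.2) ((volume.restrict (Ioi (0:ℝ))).prod volume) := by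
    refine hgn.mono' ?_ (.of_forall fun z => ?_)
    · exact (hg.smul measurable_snd).aestronglyMeasurable
    · rw [norm_smul, Real.norm_of_nonneg (hg0 z), mul_comm]
  refine hP (fun x => ∫ s in Ioi (0:ℝ), f (s, x)) (fun x => ∫ s in Ioi (0:ℝ), g (s, x))
    (c * (π / 2)) ?_ ?_ ?_ ?_ ?_ ?_ ?_ ?_ (by positivity) ?_
  · exact (hf.stronglyMeasurable.integral_prod_left').measurable
  · exact (hg.stronglyMeasurable.integral_prod_left').measurable
  · exact fun x => integral_nonneg fun s => hf0 _
  · exact fun x => integral_nonneg fun s => hg0 _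
  · exact hfi.integral_prod_right
  · exact hgi.integral_prod_right
  · have := hgn.integral_prod_right
    simpa only [integral_const_mul] using this
  · rw [← hb, integral_prod_symm _ hbi]
    simp only [integral_smul_const]
  · intro x y
    have key := san_one (p := fun s => f (s, x)) (q := fun s => g (s, y))
      (hf.comp (by fun_prop)) (hg.comp (by fun_prop)) (fun _ => hf0 _) (fun _ => hg0 _)
      (c := c * exp (-⟪x, y⟫)) (by positivity) (fun s t hs ht => by
        refine (h s t x y hs ht).trans_eq ?_
        rw [mul_assoc, ← Real.exp_add]; congr 2; ring)
    rw [integral_eq_lintegral_of_nonneg_ae (.of_forall fun _ => hf0 _)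
        ((hf.comp (by fun_prop)).aestronglyMeasurable),
      integral_eq_lintegral_of_nonneg_ae (.of_forall fun _ => hg0 _)
        ((hg.comp (by fun_prop)).aestronglyMeasurable), ← ENNReal.toReal_mul]
    refine (ENNReal.toReal_mono (by simp) key).trans_eq ?_
    rw [ENNReal.toReal_ofReal (by positivity)]; ring

theorem shear_pres (v : E) : MeasurePreserving (fun z : ℝ × E => (z.1, z.2 + z.1 • v)) (muP E) (muP E) := by
  unfold muP
  refine (MeasurePreserving.id _).skew_product (g := fun t y => y + t • v) (by fun_prop) ?_
  exact .of_forall fun t => (measurePreserving_add_right volume (t • v)).map_eq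

theorem shear_pres' (v : E) : MeasurePreserving (fun z : ℝ × E => (z.1 - ⟪v, z.2⟫, z.2)) volume volume := by
  have h1 : MeasurePreserving (fun z : E × ℝ => (z.1, z.2 - ⟪v, z.1⟫))
      ((volume : Measure E).prod volume) ((volume : Measure E).prod volume) := by
    refine (MeasurePreserving.id _).skew_product (g := fun (x : E) (t : ℝ) => t - ⟪v, x⟫) (by fun_prop) ?_
    exact .of_forall fun t => (measurePreserving_sub_right volume _).map_eq
  have h2 := (Measure.measurePreserving_swap (μ := (volume : Measure E)) (ν := (volume : Measure ℝ))).comp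
    (h1.comp (Measure.measurePreserving_swap (μ := (volume : Measure ℝ)) (ν := (volume : Measure E))))
  exact h2

theorem half_shear {C : ℝ} (hP : SantaloP E C) (v : E) {f g : ℝ × E → ℝ} {c : ℝ} (hf : Measurable f)
    (hg : Measurable g) (hf0 : ∀ x, 0 ≤ f x) (hg0 : ∀ x, 0 ≤ g x)
    (hfi : Integrable (fun z : ℝ × E => f (z.1 - ⟪v, z.2⟫, z.2)) (muP E)) (hgi : Integrable g (muP E))
    (hgn : Integrable (fun z => z.1 * g z) (muP E))
    (hgn' : Integrable (fun z => g z • z.2) (muP E))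
    (hb : ∫ z, g z • z.2 ∂(muP E) = (∫ z, z.1 * g z ∂(muP E)) • v) (hc : 0 ≤ c)
    (h : ∀ s t x y, f (s, x) * g (t, y) ≤ c * exp (-(s * t + ⟪x, y⟫))) :
    (∫ z : ℝ × E, f (z.1 - ⟪v, z.2⟫, z.2) ∂(muP E)) * (∫ z, g z ∂(muP E)) ≤ c * (π / 2) * C := by
  have hs := shear_pres v
  have hem : MeasurableEmbedding (fun z : ℝ × E => (z.1, z.2 + z.1 • v)) := by
    refine (Homeomorph.measurableEmbedding 
      { toFun := fun z : ℝ × E => (z.1, z.2 + z.1 • v)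
        invFun := fun z : ℝ × E => (z.1, z.2 - z.1 • v)
        left_inv := fun z => by simp
        right_inv := fun z => by simp
        continuous_toFun := by fun_prop
        continuous_invFun := by fun_prop })
  have hi3 : Integrable (fun z : ℝ × E => g z • (z.2 - z.1 • v)) (muP E) := by
    have := hgn'.sub (hgn.smul_const v)
    refine this.congr (.of_forall fun z => ?_)
    simp only [Pi.sub_apply, smul_sub, smul_smul, mul_comm]
  have e1 : ∫ z, g z ∂(muP E) = ∫ z : ℝ × E, g (z.1, z.2 + z.1 • v) ∂(muP E) :=
    (hs.integral_comp hem g).symm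
  rw [e1]
  refine half_lemma hP (hf.comp (by fun_prop)) (hg.comp (by fun_prop)) (fun _ => hf0 _)
    (fun _ => hg0 _) hfi ?_ ?_ ?_ hc ?_
  · exact (hs.integrable_comp_emb hem).2 hgi
  · have := ((hs.integrable_comp_emb hem).2 hi3).norm
    refine this.congr (.of_forall fun z => ?_)
    simp only [Function.comp, add_sub_cancel_right, norm_smul, Real.norm_of_nonneg (hg0 _), mul_comm]
  · have h1 := hs.integral_comp hem (fun z : ℝ × E => g z • (z.2 - z.1 • v))
    simp only [add_sub_cancel_right] at h1
    rw [h1]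
    have h2 : ∀ z : ℝ × E, g z • (z.2 - z.1 • v) = g z • z.2 - (z.1 * g z) • v := by
      intro z; simp only [smul_sub, smul_smul, mul_comm]
    simp_rw [h2]
    rw [integral_sub hgn' (hgn.smul_const v), integral_smul_const, hb, sub_self]
  · intro s t x y _ _
    refine (h _ _ _ _).trans_eq ?_
    congr 2
    rw [inner_add_right, inner_smul_right, real_inner_comm v x]
    ring

theorem prod_step {C : ℝ} (hP : SantaloP E C) {f g : ℝ × E → ℝ} {c : ℝ} (hf : Measurable f)
    (hg : Measurable g) (hf0 : ∀ x, 0 ≤ f x) (hg0 : ∀ x, 0 ≤ g x) (hC : 0 ≤ C)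
    (hfi : Integrable f) (hgi : Integrable g)
    (hgn : Integrable (fun z => z.1 * g z))
    (hgn' : Integrable (fun z => g z • z.2))
    (hb1 : ∫ z, z.1 * g z = 0) (hb2 : ∫ z, g z • z.2 = 0) (hc : 0 ≤ c)
    (hhalf : ∫ z, g z ∂(muP E) = ∫ z, g (refl1 z) ∂(muP E))
    (h : ∀ s t x y, f (s, x) * g (t, y) ≤ c * exp (-(s * t + ⟪x, y⟫))) :
    (∫ z, f z) * (∫ z, g z) ≤ c * (2 * π * C) := by
  obtain ⟨g1, g2, g3⟩ := muP_integral hgi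
  obtain ⟨n1, n2, n3⟩ := muP_integral hgn
  obtain ⟨b1, b2, b3⟩ := muP_integral hgn'
  set m := ∫ z, z.1 * g z ∂(muP E)
  set w := ∫ z, g z • z.2 ∂(muP E)
  have n2' : Integrable (fun z : ℝ × E => z.1 * g (refl1 z)) (muP E) := by
    refine n2.neg.congr (.of_forall fun z => ?_)
    simp [refl1]
  have hm' : ∫ z : ℝ × E, z.1 * g (refl1 z) ∂(muP E) = m := by
    have : ∫ z : ℝ × E, (refl1 z).1 * g (refl1 z) ∂(muP E) =
        - ∫ z : ℝ × E, z.1 * g (refl1 z) ∂(muP E) := by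
      rw [← integral_neg]; congr 1; ext z; simp [refl1]
    rw [this, hb1] at n3
    linarith
  have hw' : ∫ z : ℝ × E, g (refl1 z) • z.2 ∂(muP E) = -w := by
    rw [hb2] at b3
    exact (neg_eq_of_add_eq_zero_right b3.symm).symm
  by_cases hm : m = 0
  · have h0 : 0 ≤ᵐ[muP E] fun z : ℝ × E => z.1 * g z := by
      have : ∀ᵐ z ∂(muP E), 0 < z.1 := by
        have := (Measure.quasiMeasurePreserving_fst (μ := volume.restrict (Ioi (0:ℝ)))
          (ν := (volume : Measure E))).ae (p := fun s => 0 < s) (self_mem_ae_restrict measurableSet_Ioi)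
        exact this
      filter_upwards [this] with z hz
      exact mul_nonneg hz.le (hg0 z)
    have h1 := (integral_eq_zero_iff_of_nonneg_ae h0 n1).1 hm
    have h2 : ∫ z, g z ∂(muP E) = 0 := by
      refine integral_eq_zero_of_ae ?_
      have : ∀ᵐ z ∂(muP E), 0 < z.1 := by
        have := (Measure.quasiMeasurePreserving_fst (μ := volume.restrict (Ioi (0:ℝ)))
          (ν := (volume : Measure E))).ae (p := fun s => 0 < s) (self_mem_ae_restrict measurableSet_Ioi)
        exact this
      filter_upwards [this, h1] with z hz hz1
      simpa [hz.ne'] using hz1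
    rw [g3, ← hhalf, h2]
    simp; positivity
  set v : E := m⁻¹ • w
  have hmv : m • v = w := by simp [v, smul_smul, hm]
  have hf1 : Integrable (fun z : ℝ × E => f (z.1 - ⟪v, z.2⟫, z.2)) :=
    (shear_pres' v).integrable_comp hf.aestronglyMeasurable |>.2 hfi
  have ef : ∫ z : ℝ × E, f (z.1 - ⟪v, z.2⟫, z.2) = ∫ z, f z := by
    have := integral_map (μ := (volume : Measure (ℝ × E))) (shear_pres' v).measurable.aemeasurable (f := f) hf.aestronglyMeasurable
    rw [(shear_pres' v).map_eq] at this
    exact this.symm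
  obtain ⟨f1, f2, f3⟩ := muP_integral hf1
  have k1 := half_shear hP v hf hg hf0 hg0 f1 g1 n1 b1 hmv.symm hc h
  have ee : (fun z : ℝ × E => f (refl1 (z.1 - ⟪-v, z.2⟫, z.2))) =
      fun z : ℝ × E => f ((refl1 z).1 - ⟪v, (refl1 z).2⟫, (refl1 z).2) := by
    ext z; simp only [refl1, inner_neg_left]; congr 2; ring
  have k2 := half_shear hP (-v) (f := fun z => f (refl1 z)) (g := fun z => g (refl1 z))
    (hf.comp measurable_refl1) (hg.comp measurable_refl1) (fun _ => hf0 _) (fun _ => hg0 _)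
    (by rw [ee]; exact f2) g2 n2' b2 (by rw [hw', hm', smul_neg, hmv]) hc
    (fun s t x y => by simpa [refl1] using h (-s) (-t) x y)
  rw [ee] at k2
  rw [← ef, f3, g3, ← hhalf]
  rw [← hhalf] at k2
  linarith
end prodstep

theorem exists_median {f : ℝ → ℝ} (hf : Integrable f) (hpos : 0 < ∫ x, f x) :
    ∃ z, ∫ x in Ioi z, f x = (∫ x, f x) / 2 := by
  have hc : Continuous fun z => ∫ x in (0:ℝ)..z, f x :=
    intervalIntegral.continuous_primitive (fun a b => hf.intervalIntegrable) 0
  have ht := intervalIntegral_tendsto_integral_Ioi 0 hf.integrableOn Filter.tendsto_id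
  have hb := intervalIntegral_tendsto_integral_Iic 0 hf.integrableOn Filter.tendsto_id
  have hsum : (∫ x in Iic (0:ℝ), f x) + ∫ x in Ioi (0:ℝ), f x = ∫ x, f x := by
    rw [← compl_Iic]; exact integral_add_compl measurableSet_Iic hf
  obtain ⟨z1, h1⟩ := (ht.eventually (lt_mem_nhds (show (∫ x in Ioi (0:ℝ), f x) - (∫ x, f x) / 2 <
    ∫ x in Ioi (0:ℝ), f x by linarith))).exists
  obtain ⟨z2, h2⟩ := (hb.eventually (lt_mem_nhds (show (∫ x in Iic (0:ℝ), f x) - (∫ x, f x) / 2 <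
    ∫ x in Iic (0:ℝ), f x by linarith))).exists
  rw [intervalIntegral.integral_symm] at h2
  obtain ⟨z, hz⟩ := mem_range_of_exists_le_of_exists_ge
    (c := (∫ x in Ioi (0:ℝ), f x) - (∫ x, f x) / 2) hc ⟨z2, by simp only [id] at *; linarith⟩
      ⟨z1, h1.le⟩
  refine ⟨z, ?_⟩
  have := intervalIntegral.integral_interval_add_Ioi (a := 0) (b := z) hf.integrableOn hf.integrableOn
  simp only at hz
  linarith

theorem lint_split {φ : ℝ → ENNReal} (hφ : Measurable φ) :
    ∫⁻ t, φ t = (∫⁻ t in Ioi (0:ℝ), φ t) + ∫⁻ t in Ioi (0:ℝ), φ (-t) := by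
  have := (Measure.measurePreserving_neg (volume : Measure ℝ)).restrict_preimage
      (s := Iio 0) measurableSet_Iio
  simp at this
  rw [this.lintegral_comp hφ, setLIntegral_congr Ioi_ae_eq_Ici, add_comm, ← compl_Ici]
  rw [add_comm, lintegral_add_compl _ measurableSet_Ici]

theorem santalo_one : SantaloP ℝ (2 * π) := by
  intro f g c hf hg hf0 hg0 hfi hgi hgn hb hc h
  rcases (integral_nonneg (fun x => hf0 x) : 0 ≤ ∫ x, f x).eq_or_lt with h0 | hpos
  · rw [← h0]; simp; positivity
  obtain ⟨z, hz⟩ := exists_median hfi hpos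
  set T := ∫ x, f x
  have hz2 : ∫ x in Iic z, f x = T / 2 := by
    have : (∫ x in Iic z, f x) + ∫ x in Ioi z, f x = T := by
      rw [← compl_Iic]; exact integral_add_compl measurableSet_Iic hfi
    linarith
  have m1 : ∫⁻ s in Ioi (0:ℝ), ENNReal.ofReal (f (z + s)) = ENNReal.ofReal (T / 2) := by
    have h1 := (measurePreserving_add_left (volume : Measure ℝ) z).restrict_preimage
      (s := Ioi z) measurableSet_Ioi
    simp at h1
    rw [← hz, ofReal_integral_eq_lintegral_ofReal hfi.integrableOn (.of_forall hf0)]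
    exact h1.lintegral_comp (f := fun x => ENNReal.ofReal (f x)) (by fun_prop)
  have m2 : ∫⁻ s in Ioi (0:ℝ), ENNReal.ofReal (f (z - s)) = ENNReal.ofReal (T / 2) := by
    have h1 := (Measure.measurePreserving_sub_left (volume : Measure ℝ) z).restrict_preimage
      (s := Iic z) measurableSet_Iic
    simp at h1
    rw [← hz2, ofReal_integral_eq_lintegral_ofReal hfi.integrableOn (.of_forall hf0),
      setLIntegral_congr Ioi_ae_eq_Ici]
    exact h1.lintegral_comp (f := fun x => ENNReal.ofReal (f x)) (by fun_prop)
  have k1 := san_one (p := fun s => f (z + s)) (q := fun t => g t * exp (z * t))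
    (by fun_prop) (by fun_prop) (fun _ => hf0 _) (fun t => mul_nonneg (hg0 _) (exp_pos _).le) hc
    (fun s t _ _ => by
      have := h (z + s) t
      rw [← mul_assoc]
      calc _ ≤ (c * exp (-⟪z + s, t⟫)) * exp (z * t) := by gcongr
        _ = _ := by
          rw [mul_assoc, ← Real.exp_add]; congr 2; simp; ring)
  have k2 := san_one (p := fun s => f (z - s)) (q := fun t => g (-t) * exp (z * (-t)))
    (by fun_prop) (by fun_prop) (fun _ => hf0 _) (fun t => mul_nonneg (hg0 _) (exp_pos _).le) hc
    (fun s t _ _ => by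
      have := h (z - s) (-t)
      rw [← mul_assoc]
      calc _ ≤ (c * exp (-⟪z - s, -t⟫)) * exp (z * (-t)) := by gcongr
        _ = _ := by
          rw [mul_assoc, ← Real.exp_add]; congr 2; simp; ring)
  rw [m1] at k1
  rw [m2] at k2
  have k := add_le_add k1 k2
  rw [← mul_add, ← lint_split (φ := fun t => ENNReal.ofReal (g t * exp (z * t))) (by fun_prop),
    ← ENNReal.ofReal_add (by positivity) (by positivity)] at k
  set I := ∫⁻ t, ENNReal.ofReal (g t * exp (z * t))
  have hI : I ≠ ⊤ := by
    intro hI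
    rw [hI, ENNReal.mul_top (by simp; positivity)] at k
    simp at k
  have hexpInt : Integrable (fun t => g t * exp (z * t)) := by
    refine ⟨by fun_prop, ?_⟩
    rw [hasFiniteIntegral_iff_ofReal (.of_forall fun t => mul_nonneg (hg0 _) (exp_pos _).le)]
    exact lt_top_iff_ne_top.2 hI
  have hgn' : Integrable (fun t => g t * t) := by
    refine hgn.mono' (by fun_prop) (.of_forall fun t => ?_)
    rw [norm_mul, Real.norm_of_nonneg (hg0 _), mul_comm]
  have hle : ∫ t, g t ≤ ∫ t, g t * exp (z * t) := by
    have e : ∫ t, g t = ∫ t, (g t + z * (g t * t)) := by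
      rw [integral_add hgi (hgn'.const_mul z), integral_const_mul]
      simp only [smul_eq_mul] at hb
      rw [hb]; simp
    rw [e]
    refine integral_mono (hgi.add (hgn'.const_mul z)) hexpInt fun t => ?_
    have := Real.add_one_le_exp (z * t)
    have := hg0 t
    simp only
    nlinarith
  have e2 : ∫ t, g t * exp (z * t) = I.toReal :=
    integral_eq_lintegral_of_nonneg_ae (.of_forall fun t => mul_nonneg (hg0 _) (exp_pos _).le)
      (by fun_prop)
  have k' := ENNReal.toReal_mono (by simp) k
  rw [ENNReal.toReal_mul, ENNReal.toReal_ofReal (by positivity),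
    ENNReal.toReal_ofReal (by positivity), ← e2] at k'
  nlinarith

theorem santalo_iso {E F : Type} [NormedAddCommGroup E] [InnerProductSpace ℝ E] [FiniteDimensional ℝ E]
    [MeasurableSpace E] [BorelSpace E] [NormedAddCommGroup F] [InnerProductSpace ℝ F]
    [FiniteDimensional ℝ F] [MeasurableSpace F] [BorelSpace F] {C : ℝ} (e : E ≃ₗᵢ[ℝ] F)
    (hE : SantaloP E C) : SantaloP F C := by
  intro f g c hf hg hf0 hg0 hfi hgi hgn hb hc h
  have hm := e.measurePreserving
  have hem : MeasurableEmbedding e := e.toHomeomorph.measurableEmbedding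
  have := hE (fun x => f (e x)) (fun x => g (e x)) c (hf.comp hm.measurable) (hg.comp hm.measurable)
    (fun _ => hf0 _) (fun _ => hg0 _) ((hm.integrable_comp_emb hem).2 hfi)
    ((hm.integrable_comp_emb hem).2 hgi)
    (by simpa [Function.comp_def] using (hm.integrable_comp_emb hem).2 hgn) ?_ hc
    (fun x y => by simpa using h (e x) (e y))
  · rwa [hm.integral_comp hem, hm.integral_comp hem] at this
  · have h1 := hm.integral_comp hem (fun y => g y • y)
    rw [hb] at h1
    apply e.injective
    rw [map_zero, ← h1]
    have := e.toContinuousLinearEquiv.integral_comp_comm (μ := volume) (fun y => g (e y) • y)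
    simpa using this.symm

theorem hyperplane_null {X : Type} [NormedAddCommGroup X] [InnerProductSpace ℝ X]
    [FiniteDimensional ℝ X] [MeasurableSpace X] [BorelSpace X] {u : X} (hu : u ≠ 0) :
    ∀ᵐ y : X, ⟪u, y⟫ ≠ 0 := by
  have h1 := Measure.addHaar_submodule (volume : Measure X) (ℝ ∙ u)ᗮ (fun h => hu (by
    have : u ∈ (ℝ ∙ u)ᗮ := by rw [h]; trivial
    rw [Submodule.mem_orthogonal_singleton_iff_inner_right] at this
    exact inner_self_eq_zero.1 this))
  rw [ae_iff]
  refine measure_mono_null ?_ h1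
  intro y hy
  simp only [ne_eq, not_not, mem_ofPred_eq] at hy
  exact Submodule.mem_orthogonal_singleton_iff_inner_right.2 hy

theorem exists_halving {X : Type} [NormedAddCommGroup X] [InnerProductSpace ℝ X]
    [FiniteDimensional ℝ X] [MeasurableSpace X] [BorelSpace X] (hX : 1 < Module.finrank ℝ X)
    {g : X → ℝ} (hg : Integrable g) :
    ∃ u : X, ‖u‖ = 1 ∧ ∫ y in {y | 0 < ⟪u, y⟫}, g y = ∫ y in {y | 0 < ⟪-u, y⟫}, g y := by
  have hrank : 1 < Module.rank ℝ X := by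
    rw [← Module.finrank_eq_rank]; exact_mod_cast hX
  have hmeas : ∀ u : X, MeasurableSet {y : X | 0 < ⟪u, y⟫} := fun u =>
    measurableSet_lt measurable_const (by fun_prop)
  let φ : X → ℝ := fun u => ∫ y, ({y : X | 0 < ⟪u, y⟫}).indicator g y
  have hφ : ∀ u : X, u ≠ 0 → ContinuousAt φ u := by
    intro u hu
    refine continuousAt_of_dominated (bound := fun y => ‖g y‖) ?_ ?_ hg.norm ?_
    · exact .of_forall fun v => (hg.indicator (hmeas v)).aestronglyMeasurable
    · exact .of_forall fun v => .of_forall fun y => norm_indicator_le_norm_self _ _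
    · filter_upwards [hyperplane_null hu] with y hy
      have hcont : ContinuousAt (fun v : X => ⟪v, y⟫) u := by fun_prop
      rcases lt_or_gt_of_ne hy with hy | hy
      · have : (fun v : X => ({z : X | 0 < ⟪v, z⟫}).indicator g y) =ᶠ[nhds u] fun _ => 0 := by
          filter_upwards [hcont.eventually (gt_mem_nhds hy)] with v hv
          apply indicator_of_notMem
          simp only [mem_ofPred_eq]; linarith
        exact continuousAt_const.congr this.symm
      · have : (fun v : X => ({z : X | 0 < ⟪v, z⟫}).indicator g y) =ᶠ[nhds u] fun _ => g y := by
          filter_upwards [hcont.eventually (lt_mem_nhds hy)] with v hv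
          exact indicator_of_mem (s := {z : X | 0 < ⟪v, z⟫}) hv _
        exact continuousAt_const.congr this.symm
  have hpre := isPreconnected_sphere hrank (0 : X) 1
  have : Nontrivial X := Module.nontrivial_of_finrank_pos (R := ℝ) (by omega)
  obtain ⟨e, he⟩ := exists_norm_eq X (zero_le_one)
  have hcs : ContinuousOn (fun u => φ u - φ (-u)) (sphere (0 : X) 1) := by
    intro u hu
    have hu0 : u ≠ 0 := by rintro rfl; simp at hu
    have h2 : ContinuousAt (fun u => φ (-u)) u :=
      ContinuousAt.comp (f := fun u : X => -u) (hφ (-u) (by simpa using hu0)) (by fun_prop)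
    exact ((hφ u hu0).sub h2).continuousWithinAt
  have hmem : ∀ v : X, ‖v‖ = 1 → v ∈ sphere (0 : X) 1 := fun v hv => by simpa using hv
  have : (0:ℝ) ∈ (fun u => φ u - φ (-u)) '' (sphere (0 : X) 1) := by
    rcases le_total (φ e - φ (-e)) 0 with h | h
    · refine hpre.intermediate_value (hmem e he) (hmem (-e) (by simpa using he)) hcs ⟨h, ?_⟩
      simp only [neg_neg]; linarith
    · refine hpre.intermediate_value (hmem (-e) (by simpa using he)) (hmem e he) hcs ⟨?_, h⟩
      simp only [neg_neg]; linarith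
  obtain ⟨u, hu, hu'⟩ := this
  refine ⟨u, by simpa using hu, ?_⟩
  rw [← integral_indicator (hmeas _), ← integral_indicator (hmeas _)]
  exact sub_eq_zero.1 hu'

theorem santalo_step {E : Type} [NormedAddCommGroup E] [InnerProductSpace ℝ E]
    [FiniteDimensional ℝ E] [MeasurableSpace E] [BorelSpace E] (hE : 0 < Module.finrank ℝ E)
    {C : ℝ} (hC : 0 ≤ C) (hP : SantaloP E C) : SantaloP (WithLp 2 (ℝ × E)) (2 * π * C) := by
  have hfr : Module.finrank ℝ (WithLp 2 (ℝ × E)) = Module.finrank ℝ E + 1 := by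
    rw [(WithLp.linearEquiv 2 ℝ (ℝ × E)).finrank_eq, Module.finrank_prod]; simp [add_comm]
  intro f g c hf hg hf0 hg0 hfi hgi hgn hb hc h
  obtain ⟨u, hu1, hu⟩ := exists_halving (by omega) hgi
  let e0 : WithLp 2 (ℝ × E) := WithLp.toLp 2 (1, 0)
  have he0 : ‖e0‖ = 1 := by
    simp [e0, WithLp.prod_norm_eq_of_L2]
  let R := Submodule.reflection (ℝ ∙ (e0 - u))ᗮ
  have hR : R e0 = u := Submodule.reflection_sub (by rw [he0, hu1])
  have hpT := WithLp.volume_preserving_toLp ℝ E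
  have hTh : MeasurableEmbedding (@WithLp.toLp 2 (ℝ × E)) :=
    (MeasurableEquiv.toLp 2 (ℝ × E)).measurableEmbedding
  have hm : MeasurePreserving (fun z : ℝ × E => R (WithLp.toLp 2 z)) :=
    R.measurePreserving.comp hpT
  have hem : MeasurableEmbedding (fun z : ℝ × E => R (WithLp.toLp 2 z)) :=
    R.toHomeomorph.measurableEmbedding.comp hTh
  have hin : ∀ z w : ℝ × E, ⟪R (WithLp.toLp 2 z), R (WithLp.toLp 2 w)⟫ = z.1 * w.1 + ⟪z.2, w.2⟫ := by
    intro z w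
    rw [LinearIsometryEquiv.inner_map_map, WithLp.prod_inner_apply]
    simp [mul_comm]
  have hgv : Integrable (fun y => g y • y) := by
    refine hgn.mono' ((hg.smul measurable_id).aestronglyMeasurable) (.of_forall fun z => ?_)
    rw [norm_smul, Real.norm_of_nonneg (hg0 z), mul_comm]
  -- coordinates as continuous linear functions
  have hv' : Integrable (fun z : ℝ × E => g (R (WithLp.toLp 2 z)) • R (WithLp.toLp 2 z)) :=
    (hm.integrable_comp_emb hem).2 hgv
  let L : WithLp 2 (ℝ × E) →L[ℝ] ℝ × E :=
    (WithLp.prodContinuousLinearEquiv 2 ℝ ℝ E : WithLp 2 (ℝ × E) →L[ℝ] ℝ × E).comp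
      (R.symm.toContinuousLinearEquiv : WithLp 2 (ℝ × E) →L[ℝ] WithLp 2 (ℝ × E))
  have hL : ∀ z : ℝ × E, L (R (WithLp.toLp 2 z)) = z := by
    intro z; simp [L]
  have hv1 : Integrable (fun z : ℝ × E => g (R (WithLp.toLp 2 z)) • z) := by
    have := L.integrable_comp hv'
    simpa [hL] using this
  have hv2 : ∫ z : ℝ × E, g (R (WithLp.toLp 2 z)) • z = 0 := by
    have h1 := L.integral_comp_comm hv'
    rw [hm.integral_comp hem (fun y => g y • y), hb, map_zero] at h1
    simpa [hL] using h1
  have hc1 : ∫ z : ℝ × E, z.1 * g (R (WithLp.toLp 2 z)) = 0 := by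
    have := (ContinuousLinearMap.fst ℝ ℝ E).integral_comp_comm hv1
    rw [hv2] at this
    simpa [mul_comm] using this
  have hc2 : ∫ z : ℝ × E, g (R (WithLp.toLp 2 z)) • z.2 = 0 := by
    have := (ContinuousLinearMap.snd ℝ ℝ E).integral_comp_comm hv1
    rw [hv2] at this
    simpa using this
  have hs : ∀ (v : WithLp 2 (ℝ × E)) (S : Set (ℝ × E)),
      (fun z : ℝ × E => R (WithLp.toLp 2 z)) ⁻¹' {y | 0 < ⟪v, y⟫} = S →
      ∫ y in {y | 0 < ⟪v, y⟫}, g y = ∫ z in S, g (R (WithLp.toLp 2 z)) := by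
    rintro v S rfl
    exact (hm.setIntegral_preimage_emb hem g _).symm
  have hmuP : muP E = volume.restrict {z : ℝ × E | 0 < z.1} := by
    rw [muP, Measure.volume_eq_prod]
    have := Measure.prod_restrict (μ := (volume : Measure ℝ)) (ν := (volume : Measure E)) (Ioi 0) univ
    rw [Measure.restrict_univ] at this
    rw [this]
    congr 1
    ext z; simp
  have i1 : ∀ z : ℝ × E, ⟪u, R (WithLp.toLp 2 z)⟫ = z.1 := by
    intro z
    rw [← hR]
    exact (hin (1, 0) z).trans (by simp only [one_mul, inner_zero_left, add_zero])
  have hgi' : Integrable (fun z : ℝ × E => g (R (WithLp.toLp 2 z))) :=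
    (hm.integrable_comp_emb hem).2 hgi
  have hhalf : ∫ z, g (R (WithLp.toLp 2 z)) ∂(muP E) =
      ∫ z, g (R (WithLp.toLp 2 (refl1 z))) ∂(muP E) := by
    rw [hs u {z : ℝ × E | 0 < z.1} (by ext z; simp only [mem_preimage, mem_ofPred_eq, i1]),
      hs (-u) {z : ℝ × E | z.1 < 0} (by ext z; simp only [mem_preimage, mem_ofPred_eq, i1, inner_neg_left, neg_pos])] at hu
    rw [hmuP, hu]
    have hrm : MeasurePreserving (refl1 : ℝ × E → ℝ × E) :=
      (Measure.measurePreserving_neg (volume : Measure ℝ)).prod (MeasurePreserving.id volume)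
    have hre : MeasurableEmbedding (refl1 : ℝ × E → ℝ × E) :=
      ((Homeomorph.neg ℝ).prodCongr (Homeomorph.refl E)).measurableEmbedding
    have := hrm.setIntegral_preimage_emb hre (fun z => g (R (WithLp.toLp 2 z))) {z : ℝ × E | z.1 < 0}
    rw [← this]
    congr 2
    ext z; simp [refl1]
  have := prod_step hP (f := fun z => f (R (WithLp.toLp 2 z))) (g := fun z => g (R (WithLp.toLp 2 z)))
    (c := c) (hf.comp hm.measurable) (hg.comp hm.measurable) (fun _ => hf0 _) (fun _ => hg0 _) hC
    ((hm.integrable_comp_emb hem).2 hfi) hgi'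
    (by simpa [mul_comm] using (ContinuousLinearMap.fst ℝ ℝ E).integrable_comp hv1)
    (by simpa using (ContinuousLinearMap.snd ℝ ℝ E).integrable_comp hv1)
    hc1 hc2 hc hhalf
    (fun s t x y => by
      have := h (R (WithLp.toLp 2 (s, x))) (R (WithLp.toLp 2 (t, y)))
      rwa [hin] at this)
  rwa [hm.integral_comp hem f, hm.integral_comp hem g] at this

theorem santalo_all (n : ℕ) : SantaloP (EuclideanSpace ℝ (Fin (n + 1))) ((2 * π) ^ (n + 1)) := by
  induction n with
  | zero =>
    have e : ℝ ≃ₗᵢ[ℝ] EuclideanSpace ℝ (Fin 1) :=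
      ((stdOrthonormalBasis ℝ ℝ).reindex (finCongr (by simp))).repr
    simpa using santalo_iso e santalo_one
  | succ n ih =>
    have hfr : Module.finrank ℝ (WithLp 2 (ℝ × EuclideanSpace ℝ (Fin (n + 1)))) = n + 1 + 1 := by
      rw [(WithLp.linearEquiv 2 ℝ (ℝ × _)).finrank_eq, Module.finrank_prod]; simp [add_comm]
    have e : WithLp 2 (ℝ × EuclideanSpace ℝ (Fin (n + 1))) ≃ₗᵢ[ℝ] EuclideanSpace ℝ (Fin (n + 1 + 1)) :=
      ((stdOrthonormalBasis ℝ _).reindex (finCongr hfr)).repr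
    have := santalo_iso e (santalo_step (by simp) (by positivity) ih)
    rwa [pow_succ' _ (n + 1)]

theorem supp_bdd {n : ℕ} {K : Set (EuclideanSpace ℝ (Fin n))} (hK : IsConvexBody K)
    (y : EuclideanSpace ℝ (Fin n)) : BddAbove ((fun x => ⟪x, y⟫) '' K) :=
  (hK.1.image (f := fun x => ⟪x, y⟫) (by fun_prop)).bddAbove

theorem le_supp {n : ℕ} {K : Set (EuclideanSpace ℝ (Fin n))} (hK : IsConvexBody K)
    {x : EuclideanSpace ℝ (Fin n)} (hx : x ∈ K) (y : EuclideanSpace ℝ (Fin n)) :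
    ⟪x, y⟫ ≤ supp K y := le_csSup (supp_bdd hK y) ⟨x, hx, rfl⟩

theorem supp_le {n : ℕ} {K : Set (EuclideanSpace ℝ (Fin n))} (hK : IsConvexBody K)
    {y : EuclideanSpace ℝ (Fin n)} {b : ℝ} (h : ∀ x ∈ K, ⟪x, y⟫ ≤ b) : supp K y ≤ b := by
  refine csSup_le ((hK.2.2.mono interior_subset).image _) ?_
  rintro _ ⟨x, hx, rfl⟩
  exact h x hx

theorem supp_add {n : ℕ} {K : Set (EuclideanSpace ℝ (Fin n))} (hK : IsConvexBody K)
    (y z : EuclideanSpace ℝ (Fin n)) : supp K (y + z) ≤ supp K y + supp K z := by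
  refine supp_le hK fun x hx => ?_
  rw [inner_add_right]
  exact add_le_add (le_supp hK hx y) (le_supp hK hx z)

theorem supp_smul {n : ℕ} {K : Set (EuclideanSpace ℝ (Fin n))} (hK : IsConvexBody K)
    {t : ℝ} (ht : 0 < t) (y : EuclideanSpace ℝ (Fin n)) : supp K (t • y) = t * supp K y := by
  apply le_antisymm
  · refine supp_le hK fun x hx => ?_
    rw [inner_smul_right]
    exact mul_le_mul_of_nonneg_left (le_supp hK hx y) ht.le
  · rw [mul_comm, ← le_div_iff₀ ht]
    refine supp_le hK fun x hx => ?_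
    rw [le_div_iff₀ ht]
    have := le_supp hK hx (t • y)
    rw [inner_smul_right] at this
    linarith

theorem supp_bound {n : ℕ} {K : Set (EuclideanSpace ℝ (Fin n))} (hK : IsConvexBody K) :
    ∃ R : ℝ, 0 < R ∧ (∀ x ∈ K, ‖x‖ ≤ R) ∧ ∀ y, supp K y ≤ R * ‖y‖ := by
  obtain ⟨R, hR0, hR⟩ := hK.1.isBounded.exists_pos_norm_le
  refine ⟨R, hR0, hR, fun y => supp_le hK fun x hx => ?_⟩
  exact (real_inner_le_norm x y).trans (mul_le_mul_of_nonneg_right (hR x hx) (norm_nonneg y))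

theorem supp_cont {n : ℕ} {K : Set (EuclideanSpace ℝ (Fin n))} (hK : IsConvexBody K) :
    Continuous (supp K) := by
  obtain ⟨R, hR0, -, hR⟩ := supp_bound hK
  have : LipschitzWith ⟨R, hR0.le⟩ (supp K) := by
    apply LipschitzWith.of_le_add_mul
    intro y z
    have h1 := supp_add hK z (y - z)
    have h2 := hR (y - z)
    rw [add_sub_cancel] at h1
    rw [dist_eq_norm]
    change _ ≤ _ + R * _
    linarith
  exact this.continuous

theorem supp_sub_ge {n : ℕ} {K : Set (EuclideanSpace ℝ (Fin n))} (hK : IsConvexBody K)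
    {x : EuclideanSpace ℝ (Fin n)} {r : ℝ} (hr : 0 ≤ r) (hx : closedBall x r ⊆ K)
    (y : EuclideanSpace ℝ (Fin n)) : r * ‖y‖ ≤ supp K y - ⟪x, y⟫ := by
  rcases eq_or_ne y 0 with rfl | hy
  · have := le_supp hK (hx (mem_closedBall_self hr)) 0
    simp only [inner_zero_right] at this
    simpa using this
  have hy' : 0 < ‖y‖ := norm_pos_iff.2 hy
  have := le_supp hK (hx (show x + (r / ‖y‖) • y ∈ closedBall x r by
    simp [norm_smul, abs_of_nonneg hr, div_mul_cancel₀ _ hy'.ne'])) y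
  rw [inner_add_left, inner_smul_left, real_inner_self_eq_norm_sq] at this
  simp only [conj_trivial] at this
  have h3 : r / ‖y‖ * ‖y‖ ^ 2 = r * ‖y‖ := by field_simp
  linarith

/-- Tail of the Gaussian integral. -/
noncomputable def gtail (s : ℝ) : ℝ := ∫ t in Ioi s, exp (-t ^ 2 / 2)

theorem gauss_int : Integrable (fun t : ℝ => exp (-t ^ 2 / 2)) := by
  have := integrable_exp_neg_mul_sq (b := 1 / 2) (by norm_num)
  refine this.congr (.of_forall fun t => ?_)
  simp only; congr 1; ring

theorem gtail_deriv (s : ℝ) : HasDerivAt gtail (-exp (-s ^ 2 / 2)) s := by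
  have h1 : gtail = fun s => gtail 0 - ∫ t in (0:ℝ)..s, exp (-t ^ 2 / 2) := by
    ext s
    have := intervalIntegral.integral_interval_add_Ioi (a := 0) (b := s)
      gauss_int.integrableOn gauss_int.integrableOn
    simp only [gtail]; linarith
  rw [h1]
  have hc : Continuous (fun t : ℝ => exp (-t ^ 2 / 2)) := by fun_prop
  exact (hc.integral_hasStrictDerivAt 0 s).hasDerivAt.const_sub _

theorem gtail_cont : Continuous gtail :=
  continuous_iff_continuousAt.2 fun s => (gtail_deriv s).continuousAt

theorem gauss_le (t : ℝ) : exp (-t ^ 2 / 2) ≤ exp (1 / 2) * exp (-t) := by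
  rw [← exp_add]; apply exp_le_exp.2; nlinarith [sq_nonneg (t - 1)]

theorem gtail_nonneg (s : ℝ) : 0 ≤ gtail s := integral_nonneg fun t => (exp_pos _).le

theorem gtail_anti : Antitone gtail :=
  antitone_of_hasDerivAt_nonpos gtail_deriv fun s => by simpa using (exp_pos _).le

theorem gtail_pos (s : ℝ) : 0 < gtail s := by
  apply lt_of_le_of_ne (gtail_nonneg s) 
  intro h
  have : StrictAnti gtail := strictAnti_of_hasDerivAt_neg gtail_deriv fun s => by simpa using (exp_pos _)
  have := this (lt_add_one s)
  have := gtail_nonneg (s + 1)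
  linarith

theorem gtail_le (s : ℝ) : gtail s ≤ exp (1 / 2) * exp (-s) := by
  have : ∫ t in Ioi s, exp (1 / 2) * exp (-t) = exp (1 / 2) * exp (-s) := by
    rw [integral_const_mul, integral_exp_neg_Ioi]
  rw [← this]
  apply integral_mono gauss_int.integrableOn
  · exact (integrableOn_exp_neg_Ioi s).const_mul _
  · exact gauss_le

theorem int_norm_exp {n : ℕ} (hn : 1 ≤ n) (k : ℕ) {r : ℝ} (hr : 0 < r) :
    Integrable (fun y : EuclideanSpace ℝ (Fin n) => ‖y‖ ^ k * exp (-(r * ‖y‖))) := by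
  have : Nonempty (Fin n) := ⟨⟨0, hn⟩⟩
  have : Nontrivial (EuclideanSpace ℝ (Fin n)) := inferInstance
  rw [integrable_fun_norm_addHaar volume (f := fun t => t ^ k * exp (-(r * t)))]
  have := integrableOn_rpow_mul_exp_neg_mul_rpow (p := 1) (s := ((n - 1 + k : ℕ) : ℝ)) (b := r)
    (by have : (0:ℝ) ≤ ((n - 1 + k : ℕ) : ℝ) := by positivity
        linarith) one_pos hr
  refine this.congr_fun (fun t ht => ?_) measurableSet_Ioi
  simp only [finrank_euclideanSpace, Fintype.card_fin, rpow_natCast, rpow_one, smul_eq_mul, pow_add]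
  rw [neg_mul]; ring

/-- The convex potential whose minimiser is the Santalo point. -/
noncomputable def santPot {n : ℕ} (K : Set (EuclideanSpace ℝ (Fin n)))
    (x : EuclideanSpace ℝ (Fin n)) : ENNReal :=
  ∫⁻ y, ENNReal.ofReal (gtail (supp K y - ⟪x, y⟫))

theorem santPot_lsc {n : ℕ} {K : Set (EuclideanSpace ℝ (Fin n))} (hK : IsConvexBody K) :
    LowerSemicontinuous (santPot K) := by
  have hsc := supp_cont hK
  have hgc := gtail_cont
  intro x a ha
  have h1 : ∀ y, Filter.liminf (fun x' : EuclideanSpace ℝ (Fin n) =>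
      ENNReal.ofReal (gtail (supp K y - ⟪x', y⟫))) (nhds x) =
      ENNReal.ofReal (gtail (supp K y - ⟪x, y⟫)) := fun y => by
    apply Filter.Tendsto.liminf_eq
    have : Continuous (fun x' : EuclideanSpace ℝ (Fin n) =>
      ENNReal.ofReal (gtail (supp K y - ⟪x', y⟫))) :=
      ENNReal.continuous_ofReal.comp (by fun_prop)
    exact this.tendsto x
  have h2 := lintegral_liminf_le (μ := (volume : Measure (EuclideanSpace ℝ (Fin n)))) (u := nhds x)
    (f := fun x' y => ENNReal.ofReal (gtail (supp K y - ⟪x', y⟫)))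
    (fun x' => (ENNReal.continuous_ofReal.comp
      (by fun_prop : Continuous fun y => gtail (supp K y - ⟪x', y⟫))).measurable)
  simp only [h1] at h2
  exact Filter.eventually_lt_of_lt_liminf (lt_of_lt_of_le ha h2)

theorem santPot_boundary {n : ℕ} {K : Set (EuclideanSpace ℝ (Fin n))} (hK : IsConvexBody K)
    {x : EuclideanSpace ℝ (Fin n)} (hxK : x ∈ K) (hx : x ∉ interior K) : santPot K x = ⊤ := by
  obtain ⟨f, hf⟩ := geometric_hahn_banach_open_point hK.2.1.interior isOpen_interior hx
  obtain ⟨R, hR0, hRK, hR⟩ := supp_bound hK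
  let u := (InnerProductSpace.toDual ℝ (EuclideanSpace ℝ (Fin n))).symm f
  have hfu : ∀ a, f a = ⟪a, u⟫ := fun a => by
    rw [real_inner_comm]; simp [u]
  have hu0 : u ≠ 0 := by
    intro h
    obtain ⟨a, ha⟩ := hK.2.2
    have := hf a ha
    rw [hfu, hfu, h] at this
    simp at this
  have hsup : supp K u ≤ ⟪x, u⟫ := by
    refine supp_le hK fun a ha => ?_
    have hcl : a ∈ closure (interior K) := by
      rw [hK.2.1.closure_interior_eq_closure_of_nonempty_interior hK.2.2]
      exact subset_closure ha
    have hclosed : IsClosed {a : EuclideanSpace ℝ (Fin n) | ⟪a, u⟫ ≤ ⟪x, u⟫} :=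
      isClosed_le (by fun_prop) continuous_const
    refine closure_minimal (fun b hb => ?_) hclosed hcl
    have := hf b hb
    rw [hfu, hfu] at this
    exact this.le
  have hk : ∀ k : ℕ, supp K ((k + 1 : ℝ) • u) - ⟪x, (k + 1 : ℝ) • u⟫ ≤ 0 := fun k => by
    rw [supp_smul hK (by positivity), inner_smul_right, ← mul_sub]
    exact mul_nonpos_of_nonneg_of_nonpos (by positivity) (by linarith)
  obtain ⟨δ, hδ0, hδ1, hδ2⟩ : ∃ δ : ℝ, 0 < δ ∧ δ ≤ ‖u‖ / 2 ∧ 2 * R * δ ≤ 1 :=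
    ⟨min (‖u‖ / 2) (1 / (2 * R)), by have := norm_pos_iff.2 hu0; positivity, min_le_left _ _, by
      calc _ ≤ 2 * R * (1 / (2 * R)) := by gcongr; exact min_le_right _ _
        _ = 1 := by field_simp⟩
  let A : Set (EuclideanSpace ℝ (Fin n)) := ⋃ k : ℕ, ball ((k + 1 : ℝ) • u) δ
  have hA : ∀ y ∈ A, supp K y - ⟪x, y⟫ ≤ 1 := by
    intro y hy
    obtain ⟨k, hk'⟩ := mem_iUnion.1 hy
    rw [mem_ball, dist_eq_norm] at hk'
    set z := (k + 1 : ℝ) • u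
    have h1 := supp_add hK z (y - z)
    rw [add_sub_cancel] at h1
    have h2 := hR (y - z)
    have h3 := hk k
    have h4 : -⟪x, y - z⟫ ≤ R * ‖y - z‖ := by
      have := abs_real_inner_le_norm x (y - z)
      have h5 := mul_le_mul_of_nonneg_right (hRK x hxK) (norm_nonneg (y - z))
      have := neg_abs_le (⟪x, y - z⟫)
      linarith
    rw [inner_sub_right] at h4
    have h6 : R * ‖y - z‖ ≤ R * δ := by gcongr
    change supp K z - ⟪x, z⟫ ≤ 0 at h3
    linarith
  have hAm : MeasurableSet A := MeasurableSet.iUnion fun k => measurableSet_ball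
  have hvol : volume A = ⊤ := by
    rw [measure_iUnion _ (fun k => measurableSet_ball)]
    · simp only [Measure.addHaar_ball_center]
      exact ENNReal.tsum_const_eq_top_of_ne_zero (measure_ball_pos _ _ hδ0).ne'
    · intro i j hij
      apply ball_disjoint_ball
      rw [dist_eq_norm, ← sub_smul, norm_smul]
      have : (1:ℝ) ≤ ‖(i + 1 : ℝ) - (j + 1)‖ := by
        rw [add_sub_add_right_eq_sub, Real.norm_eq_abs]
        have : (1:ℤ) ≤ |(i:ℤ) - j| := Int.one_le_abs (by omega)
        exact_mod_cast this
      nlinarith [norm_nonneg u]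
  have : ENNReal.ofReal (gtail 1) * volume A ≤ santPot K x := by
    calc _ = ∫⁻ y in A, ENNReal.ofReal (gtail 1) := by simp
      _ ≤ ∫⁻ y in A, ENNReal.ofReal (gtail (supp K y - ⟪x, y⟫)) :=
        setLIntegral_mono' hAm fun y hy => ENNReal.ofReal_le_ofReal (gtail_anti (hA y hy))
      _ ≤ _ := setLIntegral_le_lintegral _ _
  rw [hvol, ENNReal.mul_top (by simpa using gtail_pos 1)] at this
  exact top_le_iff.1 this

theorem int_of_bound {n : ℕ} (hn : 1 ≤ n) {K : Set (EuclideanSpace ℝ (Fin n))} (hK : IsConvexBody K)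
    {F : ℝ → ℝ} (hF : Continuous F) (hF0 : ∀ s, 0 ≤ F s) (hFb : ∀ s, F s ≤ exp (1 / 2) * exp (-s))
    (k : ℕ) {x : EuclideanSpace ℝ (Fin n)} (hx : x ∈ interior K) :
    Integrable (fun y => ‖y‖ ^ k * F (supp K y - ⟪x, y⟫)) := by
  have hsc := supp_cont hK
  obtain ⟨r, hr, hrK⟩ := Metric.nhds_basis_closedBall.mem_iff.1 (mem_interior_iff_mem_nhds.1 hx)
  refine ((int_norm_exp hn k hr).const_mul (exp (1 / 2))).mono'
    (by fun_prop : Continuous _).aestronglyMeasurable (.of_forall fun y => ?_)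
  rw [Real.norm_of_nonneg (mul_nonneg (by positivity) (hF0 _))]
  have h1 := supp_sub_ge hK hr.le hrK y
  calc _ ≤ ‖y‖ ^ k * (exp (1 / 2) * exp (-(r * ‖y‖))) := by
        gcongr
        refine (hFb _).trans ?_
        gcongr
    _ = _ := by ring

theorem exists_santalo_point {n : ℕ} (hn : 1 ≤ n) {K : Set (EuclideanSpace ℝ (Fin n))}
    (hK : IsConvexBody K) : ∃ x ∈ interior K,
      ∫ y, exp (-(supp K y - ⟪x, y⟫) ^ 2 / 2) • y = 0 := by
  have hsc := supp_cont hK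
  have hgc := gtail_cont
  have hgint : ∀ x ∈ interior K, Integrable (fun y => gtail (supp K y - ⟪x, y⟫)) := fun x hx => by
    simpa using int_of_bound hn hK gtail_cont gtail_nonneg gtail_le 0 hx
  have hpot : ∀ x ∈ interior K, santPot K x = ENNReal.ofReal (∫ y, gtail (supp K y - ⟪x, y⟫)) := by
    intro x hx
    rw [ofReal_integral_eq_lintegral_ofReal (hgint x hx) (.of_forall fun y => gtail_nonneg _)]
    rfl
  obtain ⟨x, hxK, hmin⟩ := LowerSemicontinuousOn.exists_isMinOn (hK.2.2.mono interior_subset) hK.1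
    ((santPot_lsc hK).lowerSemicontinuousOn K)
  have hx : x ∈ interior K := by
    by_contra hx
    obtain ⟨a, ha⟩ := hK.2.2
    have h1 := isMinOn_iff.1 hmin a (interior_subset ha)
    rw [santPot_boundary hK hxK hx, hpot a ha] at h1
    exact absurd h1 (by simp)
  refine ⟨x, hx, ?_⟩
  have hvi : Integrable (fun y => exp (-(supp K y - ⟪x, y⟫) ^ 2 / 2) • y) := by
    have := int_of_bound hn hK (F := fun t => exp (-t ^ 2 / 2)) (by fun_prop)
      (fun _ => (exp_pos _).le) gauss_le 1 hx
    refine this.mono' (by fun_prop : Continuous _).aestronglyMeasurable (.of_forall fun y => ?_)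
    rw [norm_smul, Real.norm_of_nonneg (exp_pos _).le, pow_one, mul_comm]
  apply ext_inner_left ℝ
  intro v
  rw [inner_zero_right, ← integral_inner hvi]
  obtain ⟨r, hr, hrK⟩ := Metric.nhds_basis_closedBall.mem_iff.1 (mem_interior_iff_mem_nhds.1 hx)
  let ε : ℝ := r / 2 / (‖v‖ + 1)
  have hε : 0 < ε := by positivity
  have hεv : ε * ‖v‖ ≤ r / 2 := by
    calc ε * ‖v‖ ≤ ε * (‖v‖ + 1) := by gcongr; linarith
      _ = r / 2 := by simp only [ε]; field_simp
  have hder := hasDerivAt_integral_of_dominated_loc_of_deriv_le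
    (μ := (volume : Measure (EuclideanSpace ℝ (Fin n)))) (x₀ := (0:ℝ)) (s := ball 0 ε)
    (F := fun t y => gtail (supp K y - ⟪x + t • v, y⟫))
    (F' := fun t y => exp (-(supp K y - ⟪x + t • v, y⟫) ^ 2 / 2) * ⟪v, y⟫)
    (bound := fun y => exp (1 / 2) * ‖v‖ * (‖y‖ ^ 1 * exp (-(r / 2 * ‖y‖))))
    (ball_mem_nhds 0 hε)
    (.of_forall fun t => (by fun_prop : Continuous _).aestronglyMeasurable)
    (by simpa using hgint x hx)
    ((by fun_prop : Continuous _).aestronglyMeasurable)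
    (.of_forall fun y t ht => by
      rw [norm_mul, Real.norm_of_nonneg (exp_pos _).le]
      have h1 := supp_sub_ge hK hr.le hrK y
      have h2 : t * ⟪v, y⟫ ≤ r / 2 * ‖y‖ := by
        have h3 : |t| ≤ ε := by simpa using (mem_ball_zero_iff.1 ht).le
        calc t * ⟪v, y⟫ ≤ |t| * |⟪v, y⟫| := by rw [← abs_mul]; exact le_abs_self _
          _ ≤ ε * (‖v‖ * ‖y‖) := by gcongr; exact abs_real_inner_le_norm v y
          _ = ε * ‖v‖ * ‖y‖ := by ring
          _ ≤ _ := by gcongr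
      have h4 : r / 2 * ‖y‖ ≤ supp K y - ⟪x + t • v, y⟫ := by
        rw [inner_add_left, inner_smul_left]
        simp only [conj_trivial]
        linarith
      calc _ ≤ exp (1 / 2) * exp (-(r / 2 * ‖y‖)) * (‖v‖ * ‖y‖) := by
            gcongr
            · refine (gauss_le _).trans ?_
              gcongr
            · exact norm_inner_le_norm v y
        _ = _ := by ring)
    ((int_norm_exp hn 1 (by positivity)).const_mul _)
    (.of_forall fun y t ht => by
      have h1 : HasDerivAt (fun t : ℝ => supp K y - ⟪x + t • v, y⟫) (-⟪v, y⟫) t := by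
        have : (fun t : ℝ => supp K y - ⟪x + t • v, y⟫) =
            fun t : ℝ => (supp K y - ⟪x, y⟫) - t * ⟪v, y⟫ := by
          ext t
          rw [inner_add_left, inner_smul_left]
          simp only [conj_trivial]; ring
        rw [this]
        simpa using ((hasDerivAt_id t).mul_const ⟪v, y⟫).const_sub (supp K y - ⟪x, y⟫)
      have := (gtail_deriv _).comp t h1
      rw [neg_mul_neg] at this
      exact this)
  have hloc : IsLocalMin (fun t : ℝ => ∫ y, gtail (supp K y - ⟪x + t • v, y⟫)) 0 := by
    have hc : ContinuousAt (fun t : ℝ => x + t • v) 0 := by fun_prop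
    have hmem : interior K ∈ nhds (x + (0:ℝ) • v) := by
      simpa using isOpen_interior.mem_nhds hx
    filter_upwards [hc.preimage_mem_nhds hmem] with t ht
    have h1 := isMinOn_iff.1 hmin _ (interior_subset ht)
    rw [hpot x hx, hpot _ ht, ENNReal.ofReal_le_ofReal_iff (integral_nonneg fun y => gtail_nonneg _)] at h1
    simpa using h1
  have h0 := hloc.hasDerivAt_eq_zero hder.2
  simp only [zero_smul, add_zero] at h0
  simpa [inner_smul_right] using h0

theorem polar_gauss {n : ℕ} (hn : 1 ≤ n) {h : EuclideanSpace ℝ (Fin n) → ℝ} (hc : Continuous h)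
    (hpos : ∀ u : sphere (0 : EuclideanSpace ℝ (Fin n)) 1, 0 < h u)
    (hhom : ∀ (t : ℝ), 0 < t → ∀ y, h (t • y) = t * h y)
    (hi : Integrable (fun y => exp (-(h y) ^ 2 / 2))) :
    ∫ y, exp (-(h y) ^ 2 / 2) =
      (∫ r in Ioi (0:ℝ), r ^ (n - 1) * exp (-r ^ 2 / 2)) * ∫ u, (h u)⁻¹ ^ n ∂(sphMeasure n) := by
  have : Nonempty (Fin n) := ⟨⟨0, hn⟩⟩
  have hnt : Nontrivial (EuclideanSpace ℝ (Fin n)) := inferInstance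
  have hmp := (volume : Measure (EuclideanSpace ℝ (Fin n))).measurePreserving_homeomorphUnitSphereProd
  have hem := (homeomorphUnitSphereProd (EuclideanSpace ℝ (Fin n))).measurableEmbedding
  let G : sphere (0 : EuclideanSpace ℝ (Fin n)) 1 × Ioi (0:ℝ) → ℝ :=
    fun p => exp (-(p.2.1 * h p.1) ^ 2 / 2)
  have hG : ∀ x : ({0}ᶜ : Set (EuclideanSpace ℝ (Fin n))),
      G (homeomorphUnitSphereProd _ x) = exp (-(h x.1) ^ 2 / 2) := by
    intro x
    have hx : 0 < ‖x.1‖ := norm_pos_iff.2 x.2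
    simp only [G, homeomorphUnitSphereProd_apply_snd_coe, homeomorphUnitSphereProd_apply_fst_coe]
    rw [← hhom _ hx, smul_inv_smul₀ hx.ne']
  have hGi : Integrable G ((volume : Measure (EuclideanSpace ℝ (Fin n))).toSphere.prod
      (.volumeIoiPow (Module.finrank ℝ (EuclideanSpace ℝ (Fin n)) - 1))) := by
    rw [← hmp.integrable_comp_emb hem]
    have : G ∘ (homeomorphUnitSphereProd _) =
      (fun y => exp (-(h y) ^ 2 / 2)) ∘ Subtype.val := funext hG
    rw [this, ← integrableOn_iff_comap_subtypeVal (measurableSet_singleton _).compl]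
    exact hi.integrableOn
  have h1 : ∫ y, exp (-(h y) ^ 2 / 2) = ∫ p, G p ∂((volume : Measure (EuclideanSpace ℝ (Fin n))).toSphere.prod
      (.volumeIoiPow (Module.finrank ℝ (EuclideanSpace ℝ (Fin n)) - 1))) := by
    rw [← hmp.integral_comp hem]
    simp only [hG]
    rw [integral_subtype_comap (measurableSet_singleton _).compl (fun y => exp (-(h y) ^ 2 / 2)),
      restrict_compl_singleton]
  rw [h1, integral_prod _ hGi, ← integral_const_mul]
  apply integral_congr_ae
  refine .of_forall fun u => ?_
  have hu := hpos u
  simp only [Measure.volumeIoiPow, ENNReal.ofReal, finrank_euclideanSpace, Fintype.card_fin, G]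
  rw [integral_withDensity_eq_integral_smul
      ((measurable_subtype_coe.pow_const _).real_toNNReal),
    integral_subtype_comap measurableSet_Ioi
      (fun a : ℝ => Real.toNNReal (a ^ (n - 1)) • exp (-(a * h u) ^ 2 / 2))]
  have h2 := integral_comp_mul_left_Ioi (fun t : ℝ => t ^ (n - 1) * exp (-t ^ 2 / 2)) 0 hu
  rw [mul_zero, smul_eq_mul] at h2
  have h3 : ∫ a in Ioi (0:ℝ), Real.toNNReal (a ^ (n - 1)) • exp (-(a * h u) ^ 2 / 2) =
      (h u)⁻¹ ^ (n - 1) * ∫ t in Ioi (0:ℝ), (h u * t) ^ (n - 1) * exp (-(h u * t) ^ 2 / 2) := by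
    rw [← integral_const_mul]
    refine setIntegral_congr_fun measurableSet_Ioi fun t ht => ?_
    rw [NNReal.smul_def, Real.coe_toNNReal _ (pow_nonneg ht.out.le _), smul_eq_mul, ← mul_assoc,
      ← mul_pow, inv_mul_cancel_left₀ hu.ne', mul_comm t]
  rw [h3, h2]
  obtain ⟨m, rfl⟩ : ∃ m, n = m + 1 := ⟨n - 1, by omega⟩
  simp only [Nat.add_sub_cancel, pow_succ]
  ring

theorem vol_lt {n : ℕ} {p : EuclideanSpace ℝ (Fin n) → ℝ} {A : Set (EuclideanSpace ℝ (Fin n))}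
    (hp : ∀ t : ℝ, 0 < t → ∀ x, p (t • x) = t * p x) (hA : {x | p x < 1} = A) {s : ℝ} (hs : 0 < s) :
    volume {x | p x < s} = ENNReal.ofReal (s ^ n) * volume A := by
  have : {x | p x < s} = s • A := by
    ext x
    rw [mem_smul_set_iff_inv_smul_mem₀ hs.ne', ← hA, mem_ofPred_eq, mem_ofPred_eq,
      hp _ (inv_pos.2 hs), inv_mul_lt_iff₀ hs, mul_one]
  rw [this, Measure.addHaar_smul, finrank_euclideanSpace, Fintype.card_fin,
    abs_of_pos (by positivity)]

theorem layer_eq {n : ℕ} {p q : EuclideanSpace ℝ (Fin n) → ℝ} {A B : Set (EuclideanSpace ℝ (Fin n))}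
    (hp : ∀ t : ℝ, 0 < t → ∀ x, p (t • x) = t * p x) (hA : {x | p x < 1} = A)
    (hq : ∀ t : ℝ, 0 < t → ∀ x, q (t • x) = t * q x) (hB : {x | q x < 1} = B)
    (hp0 : ∀ x, 0 ≤ p x) (hq0 : ∀ x, 0 ≤ q x) (hpc : Continuous p) (hqc : Continuous q)
    (hAB : volume A = volume B) :
    ∫⁻ x, ENNReal.ofReal (exp (-(p x) ^ 2 / 2)) = ∫⁻ x, ENNReal.ofReal (exp (-(q x) ^ 2 / 2)) := by
  rw [lintegral_eq_lintegral_meas_lt volume (.of_forall fun x => (exp_pos _).le)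
      (by fun_prop : Continuous _).measurable.aemeasurable,
    lintegral_eq_lintegral_meas_lt volume (.of_forall fun x => (exp_pos _).le)
      (by fun_prop : Continuous _).measurable.aemeasurable]
  refine setLIntegral_congr_fun measurableSet_Ioi fun t ht => ?_
  have key : ∀ r : EuclideanSpace ℝ (Fin n) → ℝ, (∀ x, 0 ≤ r x) →
      {x | t < exp (-(r x) ^ 2 / 2)} = {x | r x < √(-2 * log t)} := by
    intro r hr
    ext x
    rw [mem_ofPred_eq, mem_ofPred_eq, Real.lt_sqrt (hr x), ← log_lt_iff_lt_exp ht]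
    constructor <;> intro h <;> linarith
  rw [key p hp0, key q hq0]
  rcases (Real.sqrt_nonneg (-2 * log t)).eq_or_lt with h | h
  · rw [← h]
    have e1 : {x | p x < 0} = ∅ := by
      ext x; simpa using hp0 x
    have e2 : {x | q x < 0} = ∅ := by
      ext x; simpa using hq0 x
    rw [e1, e2]
  · rw [vol_lt hp hA h, vol_lt hq hB h, hAB]

theorem gauss_norm {n : ℕ} : Integrable (fun x : EuclideanSpace ℝ (Fin n) => exp (-‖x‖ ^ 2 / 2)) ∧
    0 < ∫ x : EuclideanSpace ℝ (Fin n), exp (-‖x‖ ^ 2 / 2) ∧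
    (∫ x : EuclideanSpace ℝ (Fin n), exp (-‖x‖ ^ 2 / 2)) ^ 2 = (2 * π) ^ n := by
  have h1 := GaussianFourier.integral_rexp_neg_mul_sq_norm (V := EuclideanSpace ℝ (Fin n))
    (b := 1 / 2) (by norm_num)
  have h2 : ∫ x : EuclideanSpace ℝ (Fin n), exp (-‖x‖ ^ 2 / 2) = (2 * π) ^ ((n:ℝ) / 2) := by
    rw [show (π / (1 / 2)) = 2 * π by ring, finrank_euclideanSpace, Fintype.card_fin] at h1
    rw [← h1]
    congr 1; ext x; congr 1; ring
  have h3 : 0 < ∫ x : EuclideanSpace ℝ (Fin n), exp (-‖x‖ ^ 2 / 2) := by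
    rw [h2]; positivity
  refine ⟨?_, h3, ?_⟩
  · by_contra h
    rw [integral_undef h] at h3
    exact lt_irrefl _ h3
  · rw [h2, ← rpow_natCast, ← rpow_mul (by positivity), ← rpow_natCast]
    congr 1; push_cast; ring

theorem exists_good_point {n : ℕ} (hn : 1 ≤ n) {K : Set (EuclideanSpace ℝ (Fin n))}
    (hK : IsConvexBody K) (hvol : vol K = vol (unitBall n)) :
    ∃ x ∈ interior K, 0 ≤ ∫ u, Real.log (supp K u - ⟪x, (u : EuclideanSpace ℝ (Fin n))⟫)
      ∂(sphMeasure n) := by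
  obtain ⟨x, hx, hbar⟩ := exists_santalo_point hn hK
  refine ⟨x, hx, ?_⟩
  have hsc := supp_cont hK
  let h : EuclideanSpace ℝ (Fin n) → ℝ := fun y => supp K y - ⟪x, y⟫
  have hc : Continuous h := by fun_prop
  obtain ⟨r, hr, hrK⟩ := Metric.nhds_basis_closedBall.mem_iff.1 (mem_interior_iff_mem_nhds.1 hx)
  have hge : ∀ y, r * ‖y‖ ≤ h y := supp_sub_ge hK hr.le hrK
  have hh0 : ∀ y, 0 ≤ h y := fun y => le_trans (by positivity) (hge y)
  have hpos : ∀ u : sphere (0 : EuclideanSpace ℝ (Fin n)) 1, 0 < h u := fun u => by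
    have := hge u
    rw [norm_eq_of_mem_sphere u] at this
    linarith
  have hhom : ∀ (t : ℝ), 0 < t → ∀ y, h (t • y) = t * h y := fun t ht y => by
    simp only [h]
    rw [supp_smul hK ht, inner_smul_right]; ring
  -- the translated body
  let K0 : Set (EuclideanSpace ℝ (Fin n)) := (fun k => x + k) ⁻¹' K
  have hK0i : interior K0 = (fun k => x + k) ⁻¹' interior K :=
    ((Homeomorph.addLeft x).preimage_interior K).symm
  have hK0c : Convex ℝ K0 := hK.2.1.translate_preimage_right x
  have hK0n : K0 ∈ nhds (0 : EuclideanSpace ℝ (Fin n)) := by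
    rw [← mem_interior_iff_mem_nhds, hK0i]
    simpa using hx
  have hvK : volume (interior K0) = volume (ball (0 : EuclideanSpace ℝ (Fin n)) 1) := by
    rw [hK0i, measure_preimage_add]
    have h1 : volume (interior K) = volume K := by
      apply measure_congr
      exact interior_ae_eq_of_null_frontier (hK.2.1.addHaar_frontier volume)
    rw [h1, ← Measure.addHaar_unitClosedBall_eq_addHaar_unitBall]
    have h2 := (ENNReal.toReal_eq_toReal_iff' hK.1.measure_lt_top.ne
      measure_closedBall_lt_top.ne).1 hvol
    exact h2
  let γ := gauge K0
  have hγc : Continuous γ := continuous_gauge hK0c hK0n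
  have hγ0 : ∀ z, 0 ≤ γ z := fun z => gauge_nonneg z
  have hγh : ∀ t : ℝ, 0 < t → ∀ z, γ (t • z) = t * γ z := fun t ht z => by
    simpa using gauge_smul_of_nonneg (s := K0) ht.le z
  have hlayer := layer_eq hγh (setOfPred_gauge_lt_one_eq_interior hK0c hK0n)
    (q := fun z => ‖z‖) (B := ball 0 1)
    (fun t ht z => by rw [norm_smul, Real.norm_of_nonneg ht.le]) (by ext z; simp) hγ0
    (fun z => norm_nonneg z) hγc continuous_norm hvK
  obtain ⟨gi, gpos, gsq⟩ := gauss_norm (n := n)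
  have hfi : Integrable (fun z => exp (-(γ z) ^ 2 / 2)) := by
    refine ⟨(by fun_prop : Continuous _).aestronglyMeasurable, ?_⟩
    rw [hasFiniteIntegral_iff_ofReal (.of_forall fun z => (exp_pos _).le), hlayer,
      ← hasFiniteIntegral_iff_ofReal (.of_forall fun z => (exp_pos _).le)]
    exact gi.2
  have hfe : ∫ z, exp (-(γ z) ^ 2 / 2) = ∫ z : EuclideanSpace ℝ (Fin n), exp (-‖z‖ ^ 2 / 2) := by
    rw [integral_eq_lintegral_of_nonneg_ae (.of_forall fun z => (exp_pos _).le) hfi.1,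
      integral_eq_lintegral_of_nonneg_ae (.of_forall fun z => (exp_pos _).le) gi.1, hlayer]
  have hhi : Integrable (fun y => exp (-(h y) ^ 2 / 2)) := by
    simpa using int_of_bound hn hK (F := fun t => exp (-t ^ 2 / 2)) (by fun_prop)
      (fun _ => (exp_pos _).le) gauss_le 0 hx
  have hhi1 : Integrable (fun y => ‖y‖ * exp (-(h y) ^ 2 / 2)) := by
    simpa using int_of_bound hn hK (F := fun t => exp (-t ^ 2 / 2)) (by fun_prop)
      (fun _ => (exp_pos _).le) gauss_le 1 hx
  have hin : ∀ z y, ⟪z, y⟫ ≤ γ z * h y := by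
    intro z y
    apply le_of_forall_pos_le_add
    intro ε hε
    have habs : Absorbent ℝ K0 := absorbent_nhds_zero hK0n
    obtain ⟨b, hb0, hb1, hb2⟩ := exists_lt_of_gauge_lt habs
      (show gauge K0 z < γ z + ε / (h y + 1) by
        have : 0 < ε / (h y + 1) := div_pos hε (by linarith [hh0 y])
        change γ z < _
        linarith)
    obtain ⟨k, hk, rfl⟩ := hb2
    have hk1 := le_supp hK (show x + k ∈ K from hk) y
    rw [inner_add_left] at hk1
    change ⟪b • k, y⟫ ≤ _
    rw [inner_smul_left]
    simp only [conj_trivial]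
    calc b * ⟪k, y⟫ ≤ b * h y := by
          apply mul_le_mul_of_nonneg_left _ hb0.le
          change _ ≤ supp K y - ⟪x, y⟫; linarith
      _ ≤ (γ (b • k) + ε / (h y + 1)) * h y := mul_le_mul_of_nonneg_right hb1.le (hh0 y)
      _ = γ (b • k) * h y + ε * (h y / (h y + 1)) := by ring
      _ ≤ γ (b • k) * h y + ε * 1 := by
          gcongr
          rw [div_le_one (by linarith [hh0 y])]; linarith
      _ = _ := by rw [mul_one]
  obtain ⟨m, rfl⟩ : ∃ m, n = m + 1 := ⟨n - 1, by omega⟩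
  have hsan := santalo_all m (fun z => exp (-(γ z) ^ 2 / 2)) (fun y => exp (-(h y) ^ 2 / 2)) 1
    (by fun_prop : Continuous _).measurable (by fun_prop : Continuous _).measurable
    (fun _ => (exp_pos _).le) (fun _ => (exp_pos _).le) hfi hhi hhi1 hbar zero_le_one
    (fun z y => by
      rw [one_mul, ← exp_add]
      apply exp_le_exp.2
      nlinarith [hin z y, sq_nonneg (γ z - h y)])
  rw [hfe, one_mul, ← gsq, sq] at hsan
  have hle := le_of_mul_le_mul_left hsan gpos
  rw [polar_gauss hn hc hpos hhom hhi, polar_gauss hn (h := fun z => ‖z‖) continuous_norm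
    (fun u => by simp) (fun t ht z => by rw [norm_smul, Real.norm_of_nonneg ht.le]) gi] at hle
  have hCpos : 0 < ∫ r in Ioi (0:ℝ), r ^ (m + 1 - 1) * exp (-r ^ 2 / 2) := by
    have h1 : 0 ≤ ∫ r in Ioi (0:ℝ), r ^ (m + 1 - 1) * exp (-r ^ 2 / 2) :=
      setIntegral_nonneg measurableSet_Ioi fun t ht =>
        mul_nonneg (pow_nonneg (le_of_lt ht) _) (exp_pos _).le
    refine lt_of_le_of_ne h1 fun h2 => ?_
    rw [polar_gauss hn (h := fun z => ‖z‖) continuous_norm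
      (fun u => by simp) (fun t ht z => by rw [norm_smul, Real.norm_of_nonneg ht.le]) gi, ← h2,
      zero_mul] at gpos
    exact lt_irrefl _ gpos
  have hle2 := le_of_mul_le_mul_left hle hCpos
  have : IsFiniteMeasure (sphMeasure (m + 1)) := by unfold sphMeasure; infer_instance
  have hcs : Continuous (fun u : sphere (0 : EuclideanSpace ℝ (Fin (m + 1))) 1 => h u) := by fun_prop
  have hli : Integrable (fun u : sphere (0 : EuclideanSpace ℝ (Fin (m + 1))) 1 => log (h u))
      (sphMeasure (m + 1)) :=
    (hcs.log fun u => (hpos u).ne').integrable_of_hasCompactSupport (HasCompactSupport.of_compactSpace _)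
  have hpi : Integrable (fun u : sphere (0 : EuclideanSpace ℝ (Fin (m + 1))) 1 => (h u)⁻¹ ^ (m + 1))
      (sphMeasure (m + 1)) :=
    ((hcs.inv₀ fun u => (hpos u).ne').pow _).integrable_of_hasCompactSupport
      (HasCompactSupport.of_compactSpace _)
  have hmono : ∫ u : sphere (0 : EuclideanSpace ℝ (Fin (m + 1))) 1,
      (1 - ((m + 1 : ℕ) : ℝ) * log (h u)) ∂(sphMeasure (m + 1)) ≤
      ∫ u : sphere (0 : EuclideanSpace ℝ (Fin (m + 1))) 1, (h u)⁻¹ ^ (m + 1) ∂(sphMeasure (m + 1)) := by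
    refine integral_mono ((integrable_const _).sub (hli.const_mul _)) hpi fun u => ?_
    simp only
    have h1 : (h u)⁻¹ ^ (m + 1) = exp (-(((m + 1 : ℕ) : ℝ) * log (h u))) := by
      rw [exp_neg, mul_comm, ← rpow_def_of_pos (hpos u), rpow_natCast, inv_pow]
    rw [h1]
    have := add_one_le_exp (-(((m + 1 : ℕ) : ℝ) * log (h u)))
    linarith
  rw [integral_sub (integrable_const _) (hli.const_mul _), integral_const_mul] at hmono
  simp only [norm_eq_of_mem_sphere, inv_one, one_pow] at hle2
  have h5 : 0 ≤ ((m + 1 : ℕ) : ℝ) * ∫ u : sphere (0 : EuclideanSpace ℝ (Fin (m + 1))) 1,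
      log (h u) ∂(sphMeasure (m + 1)) := by linarith
  exact nonneg_of_mul_nonneg_right h5 (by positivity)

/-- If `V(K) = V(B)` then `𝓔(K) ≥ 0`. -/
theorem statement6 (n : ℕ) (hn : 1 ≤ n)
    (K : Set (EuclideanSpace ℝ (Fin n))) (hK : IsConvexBody K)
    (hvol : vol K = vol (unitBall n)) :
    0 ≤ entropy K := by
  obtain ⟨x, hx, h0⟩ := exists_good_point hn hK hvol
  unfold entropy
  by_cases hb : BddAbove ((fun x => ∫ u, Real.log (supp K u - ⟪x, (u : EuclideanSpace ℝ (Fin n))⟫)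
      ∂(sphMeasure n)) '' interior K)
  · exact h0.trans (le_csSup hb ⟨x, hx, rfl⟩)
  · rw [Real.sSup_of_not_bddAbove hb]
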